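/- sup_{x ∈ ℝ} |P((I − E[I])/√Var(I) ≤ x) − Φ(x)| ≤ c/√λ, where c = 0.4785 · (m_{H³}/(m_{H²})^{3/2}) · (∫₀^∞ G³(t) p(t) dt / (∫₀^∞ G²(t) p(t) dt)^{3/2}). -/

import Mathlib

open MeasureTheory ProbabilityTheory Filter
open scoped Topology ENNReal

section

open scoped Real

/-- The weight `(1 - t) cot (π t)` in the Fourier transform of Beurling's majorant of `sgn`. -/
noncomputable def cotWeight (t : ℝ) : ℝ := (1 - t) * (Real.cos (π * t) / Real.sin (π * t))

/-- The sine transform of `cotWeight`. -/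
noncomputable def cotTransform (y : ℝ) : ℝ :=
  ∫ t in (0:ℝ)..1, cotWeight t * Real.sin (2 * π * y * t)

/-- The cosine transform of `1 - t` on the unit interval, which is half of the Fejér kernel. -/
noncomputable def halfFejer (y : ℝ) : ℝ :=
  ∫ t in (0:ℝ)..1, (1 - t) * Real.cos (2 * π * y * t)

lemma measurable_cotWeight : Measurable cotWeight := by
  unfold cotWeight; fun_prop

lemma two_mul_mul_one_sub_le_sin {t : ℝ} (h0 : 0 ≤ t) (h1 : t ≤ 1) :
    2 * t * (1 - t) ≤ Real.sin (π * t) := by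
  have hpi := Real.pi_pos
  rcases le_total t (1 / 2) with h | h
  · have := Real.mul_le_sin (x := π * t) (by positivity) (by nlinarith)
    have e : 2 / π * (π * t) = 2 * t := by field_simp
    nlinarith
  · have := Real.mul_le_sin (x := π * (1 - t)) (by nlinarith) (by nlinarith)
    have e : 2 / π * (π * (1 - t)) = 2 * (1 - t) := by field_simp
    have e2 : Real.sin (π * (1 - t)) = Real.sin (π * t) := by
      rw [mul_sub, mul_one, Real.sin_pi_sub]
    nlinarith

lemma abs_cotWeight_le {t : ℝ} (h0 : 0 < t) (h1 : t ≤ 1) : |cotWeight t| ≤ 1 / (2 * t) := by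
  rcases h1.eq_or_lt with rfl | h1
  · simp [cotWeight]
  have hs := two_mul_mul_one_sub_le_sin h0.le h1.le
  have h1' : 0 < 1 - t := by linarith
  have hs0 : 0 < Real.sin (π * t) := lt_of_lt_of_le (by positivity) hs
  unfold cotWeight
  rw [abs_mul, abs_div, abs_of_pos h1', abs_of_pos hs0, ← mul_div_assoc,
    div_le_div_iff₀ hs0 (by positivity)]
  nlinarith [mul_le_mul_of_nonneg_left (Real.abs_cos_le_one (π * t))
    (by positivity : 0 ≤ 2 * t * (1 - t))]

lemma norm_cotWeight_smul_le {E : Type*} [NormedAddCommGroup E] [NormedSpace ℝ E] {t b : ℝ}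
    (h0 : 0 < t) (h1 : t ≤ 1) {c : E} (hb : ‖c‖ ≤ b * t) : ‖cotWeight t • c‖ ≤ b / 2 := by
  rw [norm_smul, Real.norm_eq_abs]
  calc |cotWeight t| * ‖c‖ ≤ 1 / (2 * t) * (b * t) :=
        mul_le_mul (abs_cotWeight_le h0 h1) hb (norm_nonneg _) (by positivity)
    _ = b / 2 := by field_simp

lemma intervalIntegrable_cotWeight_smul {E : Type*} [NormedAddCommGroup E] [NormedSpace ℝ E]
    {b : ℝ} {c : ℝ → E} (hc : Continuous c) (hb : ∀ t, 0 < t → ‖c t‖ ≤ b * t) :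
    IntervalIntegrable (fun t => cotWeight t • c t) volume 0 1 := by
  rw [intervalIntegrable_iff_integrableOn_Ioc_of_le zero_le_one]
  refine Measure.integrableOn_of_bounded (M := b / 2) (by simp)
    (measurable_cotWeight.aestronglyMeasurable.smul hc.aestronglyMeasurable) ?_
  filter_upwards [ae_restrict_mem measurableSet_Ioc] with t ht
  exact norm_cotWeight_smul_le ht.1 ht.2 (hb t ht.1)

lemma abs_sin_two_pi_mul_le (y : ℝ) {t : ℝ} (ht : 0 < t) :
    |Real.sin (2 * π * y * t)| ≤ (2 * π * |y|) * t := by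
  refine Real.abs_sin_le_abs.trans_eq ?_
  rw [abs_mul, abs_mul, abs_of_pos Real.two_pi_pos, abs_of_pos ht]

lemma intervalIntegrable_cotWeight_mul_sin (y : ℝ) :
    IntervalIntegrable (fun t => cotWeight t * Real.sin (2 * π * y * t)) volume 0 1 :=
  intervalIntegrable_cotWeight_smul (c := fun t => Real.sin (2 * π * y * t)) (by fun_prop)
    fun _ ht => abs_sin_two_pi_mul_le y ht

lemma intervalIntegrable_one_sub_mul_cos (y : ℝ) :
    IntervalIntegrable (fun t => (1 - t) * Real.cos (2 * π * y * t)) volume 0 1 :=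
  (by fun_prop : Continuous fun t => (1 - t) * Real.cos (2 * π * y * t)).intervalIntegrable _ _

lemma cotTransform_zero : cotTransform 0 = 0 := by simp [cotTransform]

lemma cotTransform_neg (y : ℝ) : cotTransform (-y) = -cotTransform y := by
  simp [cotTransform]

lemma halfFejer_neg (y : ℝ) : halfFejer (-y) = halfFejer y := by
  simp [halfFejer]

lemma halfFejer_zero : halfFejer 0 = 1 / 2 := by
  simp only [halfFejer, mul_zero, zero_mul, Real.cos_zero, mul_one]
  rw [intervalIntegral.integral_sub (by simp) (by simp)]
  norm_num

lemma halfFejer_eq {y : ℝ} (hy : y ≠ 0) :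
    halfFejer y = Real.sin (π * y) ^ 2 / (2 * π ^ 2) * (1 / y ^ 2) := by
  have hpi := Real.pi_ne_zero
  have hd : ∀ t ∈ Set.uIcc (0:ℝ) 1, HasDerivAt
      (fun t => (1 - t) * (Real.sin (2 * π * y * t) / (2 * π * y))
        - Real.cos (2 * π * y * t) / (2 * π * y) ^ 2)
      ((1 - t) * Real.cos (2 * π * y * t)) t := by
    intro t _
    have h1 : HasDerivAt (fun t : ℝ => 2 * π * y * t) (2 * π * y) t := by
      simpa using (hasDerivAt_id t).const_mul (2 * π * y)
    have h2 := ((hasDerivAt_id t).const_sub 1).mul (h1.sin.div_const (2 * π * y))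
    have h3 := h2.sub (h1.cos.div_const ((2 * π * y) ^ 2))
    refine h3.congr_deriv ?_
    simp only [id]
    field_simp
    ring
  rw [halfFejer, intervalIntegral.integral_eq_sub_of_hasDerivAt hd
    (intervalIntegrable_one_sub_mul_cos y)]
  have e : Real.cos (2 * π * y * 1) = 1 - 2 * Real.sin (π * y) ^ 2 := by
    rw [show 2 * π * y * 1 = 2 * (π * y) by ring, Real.cos_two_mul, Real.sin_sq]; ring
  rw [e]
  simp
  field_simp
  ring

lemma halfFejer_nonneg (y : ℝ) : 0 ≤ halfFejer y := by
  rcases eq_or_ne y 0 with rfl | hy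
  · rw [halfFejer_zero]; norm_num
  · rw [halfFejer_eq hy]; positivity

lemma integral_sin_two_pi_mul {y : ℝ} (hy : y ≠ 0) :
    ∫ t in (0:ℝ)..1, Real.sin (2 * π * y * t) = Real.sin (π * y) ^ 2 / (π * y) := by
  have hpi := Real.pi_ne_zero
  have hne : 2 * π * y ≠ 0 := by positivity
  rw [intervalIntegral.integral_comp_mul_left (fun t => Real.sin t) hne, integral_sin]
  have e : Real.cos (2 * π * y * 1) = 1 - 2 * Real.sin (π * y) ^ 2 := by
    rw [show 2 * π * y * 1 = 2 * (π * y) by ring, Real.cos_two_mul, Real.sin_sq]; ring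
  rw [e]
  simp
  field_simp

lemma cotTransform_add_one_sub (y : ℝ) :
    cotTransform (y + 1) - cotTransform y = halfFejer y + halfFejer (y + 1) := by
  unfold cotTransform halfFejer
  rw [← intervalIntegral.integral_sub (intervalIntegrable_cotWeight_mul_sin _)
    (intervalIntegrable_cotWeight_mul_sin _), ← intervalIntegral.integral_add
    (intervalIntegrable_one_sub_mul_cos _) (intervalIntegrable_one_sub_mul_cos _)]
  refine intervalIntegral.integral_congr_ae ?_
  refine Eventually.of_forall fun t ht => ?_
  rw [Set.uIoc_of_le zero_le_one] at ht
  rcases ht.2.eq_or_lt with rfl | h1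
  · simp [cotWeight]
  have hs : Real.sin (π * t) ≠ 0 := by
    have h := two_mul_mul_one_sub_le_sin ht.1.le ht.2
    have := mul_pos (mul_pos two_pos ht.1) (sub_pos.2 h1)
    linarith
  obtain ⟨a, ha⟩ : ∃ a, a = 2 * π * y * t + π * t := ⟨_, rfl⟩
  rw [show 2 * π * (y + 1) * t = a + π * t by rw [ha]; ring,
    show 2 * π * y * t = a - π * t by rw [ha]; ring,
    Real.sin_add, Real.cos_add, Real.sin_sub, Real.cos_sub, cotWeight]
  generalize π * t = b at hs ⊢
  field_simp
  ring

lemma cotTransform_nat_succ (n : ℕ) : cotTransform ((n : ℝ) + 1) = 1 / 2 := by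
  induction n with
  | zero =>
    have h := cotTransform_add_one_sub 0
    have h1 : halfFejer (0 + 1) = 0 := by rw [halfFejer_eq (by norm_num)]; simp
    simp only [cotTransform_zero, halfFejer_zero, h1] at h
    simpa using h
  | succ n ih =>
    have h := cotTransform_add_one_sub ((n : ℝ) + 1)
    have h0 : ∀ m : ℕ, halfFejer ((m : ℝ) + 1) = 0 := fun m => by
      rw [halfFejer_eq (by positivity)]
      have : Real.sin (π * ((m : ℝ) + 1)) = 0 := by
        have := Real.sin_nat_mul_pi (m + 1)
        push_cast at this
        rwa [mul_comm] at this
      simp [this]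
    have h1 := h0 n
    have h2 := h0 (n + 1)
    push_cast at h2 ⊢
    linarith

lemma tendsto_cotTransform_add_nat (y : ℝ) :
    Tendsto (fun n : ℕ => cotTransform (y + n)) atTop (𝓝 (1 / 2)) := by
  let f : ℝ → ℂ := (Set.Ioc (0:ℝ) 1).indicator
    fun t => cotWeight t • (Complex.exp (Complex.I * ((-(2 * π * y * t) : ℝ) : ℂ)) - 1)
  have hf : ∀ w : ℝ, cotTransform (y + w) - cotTransform w
      = -(∫ v, Real.fourierChar (-(v * w)) • f v).im := by
    intro w
    have h_int : IntervalIntegrable (fun t => cotWeight t •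
        ((Real.fourierChar (-(t * w)) : ℂ) *
          (Complex.exp (Complex.I * ((-(2 * π * y * t) : ℝ) : ℂ)) - 1))) volume 0 1 := by
      refine intervalIntegrable_cotWeight_smul (b := 2 * π * |y|) (by fun_prop) fun t ht => ?_
      rw [norm_mul, Circle.norm_coe, one_mul]
      refine (Real.norm_exp_I_mul_ofReal_sub_one_le).trans_eq ?_
      rw [norm_neg, Real.norm_eq_abs, abs_mul, abs_mul, abs_of_pos Real.two_pi_pos, abs_of_pos ht]
    have e1 : ∫ v, Real.fourierChar (-(v * w)) • f v = ∫ t in Set.Ioc (0:ℝ) 1, cotWeight t •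
        ((Real.fourierChar (-(t * w)) : ℂ) *
          (Complex.exp (Complex.I * ((-(2 * π * y * t) : ℝ) : ℂ)) - 1)) := by
      rw [← integral_indicator measurableSet_Ioc]
      congr 1 with v
      by_cases hv : v ∈ Set.Ioc (0:ℝ) 1
      · simp only [f, Set.indicator_of_mem hv, Circle.smul_def, smul_eq_mul, Complex.real_smul]
        ring
      · simp [f, Set.indicator_of_notMem hv]
    rw [e1, ← RCLike.im_eq_complex_im, ← integral_im, ← integral_neg, cotTransform, cotTransform,
      ← intervalIntegral.integral_sub (intervalIntegrable_cotWeight_mul_sin _)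
      (intervalIntegrable_cotWeight_mul_sin _), intervalIntegral.integral_of_le zero_le_one]
    · congr 1 with t
      rw [Real.fourierChar_apply, RCLike.im_eq_complex_im]
      rw [mul_sub, mul_one, ← Complex.exp_add, Complex.smul_im, Complex.sub_im]
      rw [show ((2 * π * (-(t * w)) : ℝ) : ℂ) * Complex.I + Complex.I * ((-(2 * π * y * t) : ℝ) : ℂ)
        = ((-(2 * π * (y + w) * t) : ℝ) : ℂ) * Complex.I by push_cast; ring,
        Complex.exp_ofReal_mul_I_im, Complex.exp_ofReal_mul_I_im, Real.sin_neg,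
        show 2 * π * (-(t * w)) = -(2 * π * w * t) by ring, Real.sin_neg, smul_eq_mul]
      ring
    · rwa [intervalIntegrable_iff_integrableOn_Ioc_of_le zero_le_one] at h_int
  have hRL := Real.tendsto_integral_exp_smul_cocompact f
  have hnat : Tendsto (fun n : ℕ => ((n + 1 : ℕ) : ℝ)) atTop (cocompact ℝ) :=
    (tendsto_natCast_atTop_atTop.comp (tendsto_add_atTop_nat 1)).mono_right
      (atTop_le_cocompact)
  have h1 := (Complex.continuous_im.tendsto _).comp (hRL.comp hnat)
  have h2 : Tendsto (fun n : ℕ => cotTransform (y + ((n + 1 : ℕ) : ℝ))) atTop (𝓝 (1 / 2)) := by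
    have h3 := h1.neg.add_const (1 / 2)
    simp only [Complex.zero_im, neg_zero, zero_add] at h3
    refine h3.congr fun n => ?_
    simp only [Function.comp_apply]
    rw [← hf, Nat.cast_succ, cotTransform_nat_succ]
    ring
  exact (tendsto_add_atTop_iff_nat 1).1 h2

lemma sq_sin_pi_mul_add_nat (y : ℝ) (n : ℕ) :
    Real.sin (π * (y + n)) ^ 2 = Real.sin (π * y) ^ 2 := by
  rw [mul_add, mul_comm π (n : ℝ), Real.sin_add_nat_mul_pi, mul_pow, ← pow_mul, mul_comm n 2,
    pow_mul]
  norm_num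

lemma halfFejer_add_nat {y : ℝ} (hy : 0 < y) (n : ℕ) : halfFejer (y + n) =
    Real.sin (π * y) ^ 2 / (2 * π ^ 2) * (1 / (y + n) ^ 2) := by
  rw [halfFejer_eq (by positivity), sq_sin_pi_mul_add_nat]

lemma cotTransform_add_nat_sub_bounds {y : ℝ} (hy : 0 < y) (n : ℕ) :
    Real.sin (π * y) ^ 2 / (2 * π ^ 2) * (2 / y - 2 / (y + n))
      ≤ cotTransform (y + n) - cotTransform y ∧
    cotTransform (y + n) - cotTransform y ≤ Real.sin (π * y) ^ 2 / (2 * π ^ 2) *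
      (1 / y ^ 2 - 1 / (y + n) ^ 2 + 2 / y - 2 / (y + n)) := by
  induction n with
  | zero => simp
  | succ n ih =>
    have h := cotTransform_add_one_sub (y + n)
    have h2 := halfFejer_add_nat hy (n + 1)
    push_cast at h2 ⊢
    rw [← add_assoc] at h2 ⊢
    rw [halfFejer_add_nat hy, h2] at h
    have hS : 0 ≤ Real.sin (π * y) ^ 2 / (2 * π ^ 2) := by positivity
    generalize Real.sin (π * y) ^ 2 / (2 * π ^ 2) = S at *
    have ha : 0 < y + n := by positivity
    generalize y + (n : ℝ) = a at *
    have k1 : 2 / a - 2 / (a + 1) ≤ 1 / a ^ 2 + 1 / (a + 1) ^ 2 := by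
      have : 1 / a ^ 2 + 1 / (a + 1) ^ 2 - (2 / a - 2 / (a + 1)) = (1 / a - 1 / (a + 1)) ^ 2 := by
        field_simp; ring
      nlinarith [sq_nonneg (1 / a - 1 / (a + 1))]
    have k2 : 1 / (a + 1) ^ 2 ≤ 1 / a - 1 / (a + 1) := by
      rw [div_sub_div _ _ ha.ne' (by positivity), div_le_div_iff₀ (by positivity) (by positivity)]
      nlinarith
    have k1' := mul_le_mul_of_nonneg_left k1 hS
    have k2' := mul_le_mul_of_nonneg_left k2 hS
    exact ⟨by linear_combination ih.1 + k1' - h, by linear_combination ih.2 + 2 * k2' + h⟩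

lemma cotTransform_bounds {y : ℝ} (hy : 0 < y) :
    Real.sin (π * y) ^ 2 / (π ^ 2 * y) ≤ 1 / 2 - cotTransform y ∧
      1 / 2 - cotTransform y ≤ Real.sin (π * y) ^ 2 / (π ^ 2 * y) + halfFejer y := by
  have hlim := (tendsto_cotTransform_add_nat y).sub_const (cotTransform y)
  have hinv : Tendsto (fun n : ℕ => 2 / (y + n)) atTop (𝓝 0) :=
    tendsto_const_nhds.div_atTop (tendsto_atTop_add_const_left _ _ tendsto_natCast_atTop_atTop)
  constructor
  · have h1 := (hinv.const_sub (2 / y)).const_mul (Real.sin (π * y) ^ 2 / (2 * π ^ 2))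
    have := le_of_tendsto_of_tendsto' h1 hlim fun n => (cotTransform_add_nat_sub_bounds hy n).1
    refine le_trans (le_of_eq ?_) this
    field_simp
    ring
  · have h1 := (hinv.const_sub (1 / y ^ 2 + 2 / y)).const_mul
      (Real.sin (π * y) ^ 2 / (2 * π ^ 2))
    have := le_of_tendsto_of_tendsto' hlim h1 fun n =>
      (cotTransform_add_nat_sub_bounds hy n).2.trans (by
        refine mul_le_mul_of_nonneg_left ?_ (by positivity)
        have : 0 ≤ 1 / (y + n) ^ 2 := by positivity
        linarith)
    refine this.trans (le_of_eq ?_)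
    rw [halfFejer_eq hy.ne']
    field_simp
    ring

/-- Half of one plus Beurling's majorant of the sign function. -/
noncomputable def beurlingMajorant (y : ℝ) : ℝ :=
  1 / 2 + cotTransform y + (1 / π) * (∫ t in (0:ℝ)..1, Real.sin (2 * π * y * t)) + halfFejer y

lemma beurlingMajorant_add_neg (y : ℝ) :
    beurlingMajorant y + beurlingMajorant (-y) = 1 + 2 * halfFejer y := by
  simp only [beurlingMajorant, cotTransform_neg, halfFejer_neg]
  simp
  ring

lemma one_le_beurlingMajorant {y : ℝ} (hy : 0 ≤ y) : 1 ≤ beurlingMajorant y := by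
  rcases hy.eq_or_lt with rfl | hy
  · have := beurlingMajorant_add_neg 0
    rw [neg_zero, halfFejer_zero] at this
    linarith
  · have h := (cotTransform_bounds hy).2
    have e : 1 / π * (Real.sin (π * y) ^ 2 / (π * y)) = Real.sin (π * y) ^ 2 / (π ^ 2 * y) := by
      field_simp
    rw [beurlingMajorant, integral_sin_two_pi_mul hy.ne', e]
    linarith

lemma beurlingMajorant_nonneg (y : ℝ) : 0 ≤ beurlingMajorant y := by
  rcases le_or_gt 0 y with hy | hy
  · exact zero_le_one.trans (one_le_beurlingMajorant hy)
  · have h := (cotTransform_bounds (neg_pos.2 hy)).1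
    have e : 1 / π * (Real.sin (π * (-y)) ^ 2 / (π * (-y))) =
        Real.sin (π * (-y)) ^ 2 / (π ^ 2 * (-y)) := by
      field_simp
    have h2 := integral_sin_two_pi_mul (neg_pos.2 hy).ne'
    have h3 := beurlingMajorant_add_neg (-y)
    rw [neg_neg, beurlingMajorant, h2, e] at h3
    have := halfFejer_nonneg (-y)
    linarith

lemma cotTransform_le {y : ℝ} (hy : 0 ≤ y) : cotTransform y ≤ 1 / 2 := by
  rcases hy.eq_or_lt with rfl | hy
  · rw [cotTransform_zero]; norm_num
  · have h := (cotTransform_bounds hy).1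
    have : 0 ≤ Real.sin (π * y) ^ 2 / (π ^ 2 * y) := by positivity
    linarith

lemma continuous_cotTransform : Continuous cotTransform := by
  have : LipschitzWith ⟨π, Real.pi_pos.le⟩ cotTransform := by
    refine LipschitzWith.of_dist_le_mul fun y z => ?_
    rw [Real.dist_eq, cotTransform, cotTransform, ← intervalIntegral.integral_sub
      (intervalIntegrable_cotWeight_mul_sin _) (intervalIntegrable_cotWeight_mul_sin _)]
    have h := intervalIntegral.norm_integral_le_of_norm_le_const (a := (0:ℝ)) (b := 1)
      (f := fun t => cotWeight t * Real.sin (2 * π * y * t)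
        - cotWeight t * Real.sin (2 * π * z * t)) (C := π * |y - z|) fun t ht => by
      rw [Set.uIoc_of_le zero_le_one] at ht
      rw [← mul_sub]
      refine (norm_cotWeight_smul_le (b := 2 * π * |y - z|) ht.1 ht.2 ?_).trans_eq (by ring)
      refine (Real.abs_sin_sub_sin_le _ _).trans_eq ?_
      rw [← sub_mul, ← mul_sub, abs_mul, abs_mul, abs_of_pos Real.two_pi_pos, abs_of_pos ht.1]
    change _ ≤ π * dist y z
    simpa [Real.dist_eq] using h
  exact this.continuous

lemma continuous_halfFejer : Continuous halfFejer :=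
  intervalIntegral.continuous_parametric_intervalIntegral_of_continuous' (by fun_prop) 0 1

lemma continuous_beurlingMajorant : Continuous beurlingMajorant := by
  have : Continuous fun y => ∫ t in (0:ℝ)..1, Real.sin (2 * π * y * t) :=
    intervalIntegral.continuous_parametric_intervalIntegral_of_continuous' (by fun_prop) 0 1
  exact ((continuous_const.add continuous_cotTransform).add (continuous_const.mul this)).add
    continuous_halfFejer

lemma intervalIntegral_halfFejer_le {N : ℝ} (hN : 1 ≤ N) :
    ∫ y in (1 - N)..N, halfFejer y ≤ 1 / 2 := by
  have hE : ∀ a b, IntervalIntegrable halfFejer volume a b :=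
    fun a b => continuous_halfFejer.intervalIntegrable a b
  have hA : ∀ a b, IntervalIntegrable cotTransform volume a b :=
    fun a b => continuous_cotTransform.intervalIntegrable a b
  have hE1 : Continuous fun y => halfFejer (y + 1) :=
    continuous_halfFejer.comp (continuous_add_const 1)
  have hA1 : Continuous fun y => cotTransform (y + 1) :=
    continuous_cotTransform.comp (continuous_add_const 1)
  have h1 : ∫ y in (-N)..N, (cotTransform (y + 1) - cotTransform y)
      = ∫ y in (-N)..N, (halfFejer y + halfFejer (y + 1)) :=
    intervalIntegral.integral_congr fun y _ => cotTransform_add_one_sub y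
  rw [intervalIntegral.integral_sub (hA1.intervalIntegrable _ _) (hA _ _),
    intervalIntegral.integral_add (hE _ _) (hE1.intervalIntegrable _ _),
    intervalIntegral.integral_comp_add_right, intervalIntegral.integral_comp_add_right,
    intervalIntegral.integral_interval_sub_interval_comm' (hA _ _) (hA _ _) (hA _ _)] at h1
  have up : ∫ y in N..(N + 1), cotTransform y ≤ ∫ y in N..(N + 1), (1 / 2 : ℝ) :=
    intervalIntegral.integral_mono_on (by linarith) (hA _ _) (by simp)
      fun y hy => cotTransform_le (by linarith [hy.1])
  have lo : ∫ y in (-N)..(-N + 1), (-(1 / 2) : ℝ) ≤ ∫ y in (-N)..(-N + 1), cotTransform y :=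
    intervalIntegral.integral_mono_on (by linarith) (by simp) (hA _ _) fun y hy => by
      have := cotTransform_le (y := -y) (by linarith [hy.2])
      rw [cotTransform_neg] at this
      linarith
  simp only [intervalIntegral.integral_const, smul_eq_mul] at up lo
  have e1 := intervalIntegral.integral_add_adjacent_intervals (hE (-N) (1 - N)) (hE (1 - N) N)
  have e2 := intervalIntegral.integral_add_adjacent_intervals (hE (-N + 1) N) (hE N (N + 1))
  have p1 : 0 ≤ ∫ y in (-N)..(1 - N), halfFejer y :=
    intervalIntegral.integral_nonneg (by linarith) fun y _ => halfFejer_nonneg y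
  have p2 : 0 ≤ ∫ y in N..(N + 1), halfFejer y :=
    intervalIntegral.integral_nonneg (by linarith) fun y _ => halfFejer_nonneg y
  rw [show -N + 1 = 1 - N by ring] at *
  linarith

lemma integrable_halfFejer : Integrable halfFejer := by
  refine integrable_of_intervalIntegral_norm_bounded (ι := ℝ) (l := atTop) (1 / 2)
    (a := fun N => 1 - N) (b := id)
    (fun N => (continuous_halfFejer.intervalIntegrable (1 - N) N).1)
    (tendsto_const_nhds.add_atBot tendsto_neg_atTop_atBot) tendsto_id ?_
  filter_upwards [eventually_ge_atTop 1] with N hN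
  simpa [abs_of_nonneg (halfFejer_nonneg _)] using intervalIntegral_halfFejer_le hN

lemma integral_halfFejer_le : ∫ y, halfFejer y ≤ 1 / 2 := by
  refine le_of_tendsto (intervalIntegral_tendsto_integral (l := atTop) (a := fun N : ℝ => 1 - N)
    (b := id) integrable_halfFejer (tendsto_const_nhds.add_atBot tendsto_neg_atTop_atBot)
    tendsto_id) ?_
  filter_upwards [eventually_ge_atTop 1] with N hN
  exact intervalIntegral_halfFejer_le hN

/-- The excess of `beurlingMajorant` over the indicator function of `[0, ∞)`. -/
noncomputable def beurlingExcess (y : ℝ) : ℝ :=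
  beurlingMajorant y - (Set.Ici (0:ℝ)).indicator 1 y

lemma measurable_beurlingExcess : Measurable beurlingExcess :=
  continuous_beurlingMajorant.measurable.sub (measurable_one.indicator measurableSet_Ici)

lemma beurlingExcess_nonneg (y : ℝ) : 0 ≤ beurlingExcess y := by
  by_cases hy : y ∈ Set.Ici (0:ℝ)
  · simpa [beurlingExcess, hy] using one_le_beurlingMajorant hy
  · simpa [beurlingExcess, hy] using beurlingMajorant_nonneg y

lemma beurlingExcess_add_neg {y : ℝ} (hy : y ≠ 0) :
    beurlingExcess y + beurlingExcess (-y) = 2 * halfFejer y := by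
  have h := beurlingMajorant_add_neg y
  rcases hy.lt_or_gt with hy | hy
  · simp [beurlingExcess, hy.not_ge, hy.le]
    linarith
  · simp [beurlingExcess, hy.not_ge, hy.le]
    linarith

lemma integrable_beurlingExcess : Integrable beurlingExcess := by
  refine (integrable_halfFejer.const_mul 2).mono' measurable_beurlingExcess.aestronglyMeasurable ?_
  filter_upwards [Measure.ae_ne volume (0:ℝ)] with y hy
  rw [Real.norm_of_nonneg (beurlingExcess_nonneg y), ← beurlingExcess_add_neg hy]
  linarith [beurlingExcess_nonneg (-y)]

lemma integral_beurlingExcess_le : ∫ y, beurlingExcess y ≤ 1 / 2 := by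
  have h : ∫ y, (beurlingExcess y + beurlingExcess (-y)) = ∫ y, 2 * halfFejer y := by
    refine integral_congr_ae ?_
    filter_upwards [Measure.ae_ne volume (0:ℝ)] with y hy using beurlingExcess_add_neg hy
  rw [integral_add integrable_beurlingExcess integrable_beurlingExcess.comp_neg,
    integral_neg_eq_self, integral_const_mul] at h
  linarith [integral_halfFejer_le]

lemma mul_cos_le_sin {u : ℝ} (h0 : 0 ≤ u) (h1 : u ≤ π) : u * Real.cos u ≤ Real.sin u := by
  have hmono : MonotoneOn (fun u => Real.sin u - u * Real.cos u) (Set.Icc 0 π) := by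
    refine monotoneOn_of_hasDerivWithinAt_nonneg (f' := fun u => u * Real.sin u)
      (convex_Icc 0 π) (by fun_prop) (fun v _ => ?_) (fun v hv => ?_)
    · refine (((Real.hasDerivAt_sin v).sub ((hasDerivAt_id v).mul
        (Real.hasDerivAt_cos v))).congr_deriv ?_).hasDerivWithinAt
      simp
    · rw [interior_Icc] at hv
      exact mul_nonneg hv.1.le (Real.sin_nonneg_of_nonneg_of_le_pi hv.1.le hv.2.le)
  have := hmono (Set.left_mem_Icc.2 Real.pi_pos.le) ⟨h0, h1⟩ h0
  simpa using this

lemma mul_cos_le_mul_sin {u : ℝ} (h0 : 0 ≤ u) (h1 : u ≤ π) :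
    u * Real.cos u ≤ (1 - u ^ 2 / 3) * Real.sin u := by
  have hmono : MonotoneOn (fun u => (1 - u ^ 2 / 3) * Real.sin u - u * Real.cos u)
      (Set.Icc 0 π) := by
    refine monotoneOn_of_hasDerivWithinAt_nonneg
      (f' := fun u => u / 3 * (Real.sin u - u * Real.cos u))
      (convex_Icc 0 π) (by fun_prop) (fun v _ => ?_) (fun v hv => ?_)
    · refine ((((((hasDerivAt_id v).pow 2).div_const 3).const_sub 1).mul
        (Real.hasDerivAt_sin v)).sub ((hasDerivAt_id v).mul
        (Real.hasDerivAt_cos v))).congr_deriv ?_ |>.hasDerivWithinAt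
      simp
      ring
    · rw [interior_Icc] at hv
      exact mul_nonneg (by linarith [hv.1]) (sub_nonneg.2 (mul_cos_le_sin hv.1.le hv.2.le))
  have := hmono (Set.left_mem_Icc.2 Real.pi_pos.le) ⟨h0, h1⟩ h0
  simpa using this

lemma prawitz_polynomial_le {t w : ℝ} (h0 : 0 ≤ t) (h1 : t ≤ 1) (hw1 : 9.86 * t ^ 2 ≤ w)
    (hw2 : w ≤ 9.87 * t ^ 2) :
    (1 - (1 - t) * w / 3) ^ 2 + w * (1 - t) ^ 2 ≤ 1.05 ^ 2 := by
  have e : (1 - (1 - t) * w / 3) ^ 2 + w * (1 - t) ^ 2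
      = 1 + ((1 - t) * w) * ((1 / 3 - t) + ((1 - t) * w) / 9) := by ring
  rw [e]
  have a1 : (1 - t) * w ≤ 9.87 * (t ^ 2 * (1 - t)) := by nlinarith
  have a0 : 0 ≤ (1 - t) * w := mul_nonneg (by linarith) (by nlinarith [sq_nonneg t])
  have a2 : 9.86 * (t ^ 2 * (1 - t)) ≤ (1 - t) * w := by nlinarith
  generalize (1 - t) * w = z at *
  have ht2 : 0 ≤ t ^ 2 * (1 - t) := mul_nonneg (sq_nonneg t) (by linarith)
  rcases le_total t (1 / 3) with h | h
  · have b1 : t ^ 2 * (1 - t) ≤ 2 / 27 := by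
      nlinarith [mul_nonneg h0 (sub_nonneg.2 h), mul_nonneg (sub_nonneg.2 h)
        (sq_nonneg (t - 1 / 3)), sq_nonneg (t - 1 / 3), mul_nonneg h0 (sq_nonneg (t - 1 / 3))]
    have b2 : t ^ 2 * (1 - t) * (1 / 3 - t) ≤ 0.00435 := by
      nlinarith [sq_nonneg (t - 0.2113), mul_nonneg h0 (sq_nonneg (t - 0.2113)),
        mul_nonneg (mul_nonneg h0 (sub_nonneg.2 h)) (sq_nonneg (t - 0.2113))]
    have b3 : z * (1 / 3 - t) ≤ 9.87 * 0.00435 := by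
      nlinarith [mul_le_mul_of_nonneg_right a1 (sub_nonneg.2 h)]
    have b4 : z ≤ 9.87 * (2 / 27) := by linarith
    nlinarith
  · have b0 : t ^ 2 * (1 - t) ≤ 2 / 27 + (t - 1 / 3) / 3 := by
      nlinarith [mul_nonneg h0 (sq_nonneg (t - 1 / 3)), sq_nonneg (t - 1 / 3)]
    generalize t ^ 2 * (1 - t) = a at *
    have b1 : z * (1 / 3 - t) ≤ 9.86 * a * (1 / 3 - t) := by nlinarith
    have b2 : z ^ 2 ≤ (9.87 * a) ^ 2 := by gcongr
    have b3 : a * (10.83 * a - 9.86 * (t - 1 / 3)) ≤ 0.1025 := by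
      rcases le_total (10.83 * a) (9.86 * (t - 1 / 3)) with h' | h'
      · linarith [mul_nonneg ht2 (sub_nonneg.2 h')]
      · have h2 : a ≤ 0.12 := by linarith
        have h3 : 10.83 * a - 9.86 * (t - 1 / 3) ≤ 0.81 := by linarith
        exact (mul_le_mul h2 h3 (by linarith) (by norm_num)).trans (by norm_num)
    linarith [sq_nonneg a]

/-- The complex weight whose Fourier-type integral represents `beurlingMajorant`. -/
noncomputable def prawitzWeight (t : ℝ) : ℂ :=
  ((1 - t : ℝ) : ℂ) - ((cotWeight t + 1 / π : ℝ) : ℂ) * Complex.I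

lemma measurable_prawitzWeight : Measurable prawitzWeight := by
  have := measurable_cotWeight
  unfold prawitzWeight
  fun_prop

lemma prawitzWeight_mul_exp_re (t θ : ℝ) :
    (prawitzWeight t * Complex.exp (θ * Complex.I)).re
      = (cotWeight t + 1 / π) * Real.sin θ + (1 - t) * Real.cos θ := by
  have h : Complex.exp (θ * Complex.I) = ⟨Real.cos θ, Real.sin θ⟩ := by
    apply Complex.ext <;> simp [Complex.exp_ofReal_mul_I_re, Complex.exp_ofReal_mul_I_im]
  rw [h]
  simp [prawitzWeight]
  ring

lemma norm_prawitzWeight_le {t : ℝ} (h0 : 0 < t) (h1 : t ≤ 1) :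
    ‖prawitzWeight t‖ ≤ 1.05 / π / t := by
  have hpi := Real.pi_pos
  set X : ℝ := π * t * (cotWeight t + 1 / π) with hX
  have hXeq : X = π * t * cotWeight t + t := by rw [hX]; field_simp
  have hw1 : 9.86 * t ^ 2 ≤ (π * t) ^ 2 := by
    have : (9.86 : ℝ) ≤ π ^ 2 := by nlinarith [Real.pi_gt_d4]
    rw [mul_pow]; gcongr
  have hw2 : (π * t) ^ 2 ≤ 9.87 * t ^ 2 := by
    have : π ^ 2 ≤ (9.87 : ℝ) := by nlinarith [Real.pi_lt_d4]
    rw [mul_pow]; gcongr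
  have hbd : 0 ≤ X ∧ X ≤ 1 - (1 - t) * (π * t) ^ 2 / 3 := by
    rcases h1.eq_or_lt with rfl | h1'
    · rw [hXeq]; simp [cotWeight]
    have hs : 0 < Real.sin (π * t) := Real.sin_pos_of_pos_of_lt_pi (by positivity) (by nlinarith)
    have hcw : X = ((1 - t) * (π * t * Real.cos (π * t)) + t * Real.sin (π * t))
        / Real.sin (π * t) := by
      rw [hXeq, cotWeight]; field_simp
    constructor
    · rw [hcw]
      refine div_nonneg ?_ hs.le
      have := mul_cos_le_sin (u := π - π * t) (by nlinarith) (by nlinarith)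
      rw [Real.cos_pi_sub, Real.sin_pi_sub] at this
      nlinarith
    · rw [hcw, div_le_iff₀ hs]
      have := mul_cos_le_mul_sin (u := π * t) (by nlinarith) (by nlinarith)
      nlinarith [mul_le_mul_of_nonneg_left this (sub_nonneg.2 h1)]
  have hpoly := prawitz_polynomial_le h0.le h1 hw1 hw2
  have hsq : (π * t * ‖prawitzWeight t‖) ^ 2 ≤ 1.05 ^ 2 := by
    have : ‖prawitzWeight t‖ ^ 2 = (1 - t) ^ 2 + (cotWeight t + 1 / π) ^ 2 := by
      rw [← Complex.normSq_eq_norm_sq, Complex.normSq_apply]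
      simp [prawitzWeight]
      ring
    rw [mul_pow, this]
    have : X ^ 2 ≤ (1 - (1 - t) * (π * t) ^ 2 / 3) ^ 2 := by
      have := hbd.1; have := hbd.2; gcongr
    calc _ = X ^ 2 + (π * t) ^ 2 * (1 - t) ^ 2 := by rw [hX]; ring
      _ ≤ _ := by linarith
  have := abs_le_of_sq_le_sq hsq (by norm_num)
  rw [div_div, le_div_iff₀ (by positivity)]
  linarith [(abs_le.1 this).2, mul_comm (π * t) ‖prawitzWeight t‖]

/-- The integrand in the representation of the rescaled majorant. -/
noncomputable def majorantKernel (T x : ℝ) (z : ℝ × ℝ) : ℝ :=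
  (prawitzWeight z.1 * Complex.exp ((T * z.1 * (z.2 - x) : ℝ) * Complex.I)).re

lemma measurable_majorantKernel (T x : ℝ) : Measurable (majorantKernel T x) := by
  unfold majorantKernel
  exact Complex.measurable_re.comp
    ((measurable_prawitzWeight.comp measurable_fst).mul (by fun_prop))

lemma abs_majorantKernel_le {T : ℝ} (hT : 0 < T) (x v : ℝ) {t : ℝ} (h0 : 0 < t) (h1 : t ≤ 1) :
    |majorantKernel T x (t, v)| ≤ T * |v - x| + 2 := by
  have hpi := Real.pi_gt_three
  rw [majorantKernel, prawitzWeight_mul_exp_re]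
  set θ := T * t * (v - x) with hθ
  have a1 : |cotWeight t * Real.sin θ| ≤ T * |v - x| := by
    rw [abs_mul]
    calc _ ≤ 1 / (2 * t) * |θ| :=
          mul_le_mul (abs_cotWeight_le h0 h1) Real.abs_sin_le_abs (abs_nonneg _) (by positivity)
      _ = T * |v - x| / 2 := by
          rw [hθ, abs_mul, abs_of_pos (mul_pos hT h0)]; field_simp
      _ ≤ _ := by linarith [mul_nonneg hT.le (abs_nonneg (v - x))]
  have a2 : |1 / π * Real.sin θ| ≤ 1 := by
    rw [abs_mul, abs_of_pos (by positivity)]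
    refine mul_le_one₀ ?_ (abs_nonneg _) (Real.abs_sin_le_one _)
    rw [div_le_one (by positivity)]; linarith
  have a3 : |(1 - t) * Real.cos θ| ≤ 1 := by
    rw [abs_mul, abs_of_nonneg (by linarith)]
    exact mul_le_one₀ (by linarith) (abs_nonneg _) (Real.abs_cos_le_one _)
  rw [add_mul]
  refine (abs_add_le _ _).trans ?_
  have := abs_add_le (cotWeight t * Real.sin θ) (1 / π * Real.sin θ)
  linarith

lemma beurlingMajorant_eq_integral (T x v : ℝ) :
    beurlingMajorant (T * (v - x) / (2 * π))
      = 1 / 2 + ∫ t in (0 : ℝ)..1, majorantKernel T x (t, v) := by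
  have hpi := Real.pi_pos
  set y := T * (v - x) / (2 * π) with hy
  have h : ∀ t : ℝ, majorantKernel T x (t, v) = cotWeight t * Real.sin (2 * π * y * t)
      + 1 / π * Real.sin (2 * π * y * t) + (1 - t) * Real.cos (2 * π * y * t) := by
    intro t
    rw [majorantKernel, prawitzWeight_mul_exp_re]
    have : T * t * (v - x) = 2 * π * y * t := by rw [hy]; field_simp
    simp only [this]; ring
  have hs : IntervalIntegrable (fun t => 1 / π * Real.sin (2 * π * y * t)) volume 0 1 :=
    (by fun_prop : Continuous _).intervalIntegrable _ _
  simp_rw [h]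
  rw [intervalIntegral.integral_add ((intervalIntegrable_cotWeight_mul_sin y).add hs)
    (intervalIntegrable_one_sub_mul_cos y), intervalIntegral.integral_add
    (intervalIntegrable_cotWeight_mul_sin y) hs, intervalIntegral.integral_const_mul,
    beurlingMajorant, cotTransform, halfFejer]
  ring

section Smoothing

variable {ρ : Measure ℝ} [IsProbabilityMeasure ρ]

lemma integrable_majorantKernel (hρ : Integrable id ρ) {T : ℝ} (hT : 0 < T) (x : ℝ) :
    Integrable (majorantKernel T x) ((volume.restrict (Set.Ioc (0 : ℝ) 1)).prod ρ) := by
  have hb : Integrable (fun v : ℝ => T * |v - x| + 2) ρ :=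
    (((hρ.sub (integrable_const x)).abs).const_mul T).add (integrable_const 2)
  refine Integrable.mono' (hb.comp_snd (volume.restrict (Set.Ioc (0 : ℝ) 1)))
    (measurable_majorantKernel T x).aestronglyMeasurable ?_
  have : ∀ᵐ z ∂((volume.restrict (Set.Ioc (0 : ℝ) 1)).prod ρ), z.1 ∈ Set.Ioc (0 : ℝ) 1 :=
    Measure.quasiMeasurePreserving_fst.ae (ae_restrict_mem measurableSet_Ioc)
  filter_upwards [this] with z hz
  exact abs_majorantKernel_le hT x z.2 hz.1 hz.2

lemma integral_majorantKernel (T x t : ℝ) :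
    ∫ v, majorantKernel T x (t, v) ∂ρ
      = (prawitzWeight t * Complex.exp (-(T * t * x : ℝ) * Complex.I)
          * charFun ρ (T * t)).re := by
  have h : ∀ v : ℝ, prawitzWeight t * Complex.exp ((T * t * (v - x) : ℝ) * Complex.I)
      = prawitzWeight t * Complex.exp (-(T * t * x : ℝ) * Complex.I)
        * Complex.exp ((T * t : ℝ) * v * Complex.I) := by
    intro v
    rw [mul_assoc (prawitzWeight t), ← Complex.exp_add]
    congr 2
    push_cast
    ring
  have h_int : Integrable (fun v : ℝ => Complex.exp ((T * t : ℝ) * v * Complex.I)) ρ := by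
    refine Integrable.of_bound (C := 1) (by fun_prop) (ae_of_all _ fun v => ?_)
    rw [← Complex.ofReal_mul, Complex.norm_exp_ofReal_mul_I]
  have h_int_mul : Integrable (fun v : ℝ => prawitzWeight t *
      Complex.exp ((T * t * (v - x) : ℝ) * Complex.I)) ρ := by
    simp_rw [h]; exact h_int.const_mul _
  rw [charFun_apply_real, ← integral_const_mul]
  simp_rw [← h]
  exact integral_re h_int_mul

lemma integrable_beurlingMajorant_comp (hρ : Integrable id ρ) {T : ℝ} (hT : 0 < T) (x : ℝ) :
    Integrable (fun v => beurlingMajorant (T * (v - x) / (2 * π))) ρ := by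
  simp_rw [beurlingMajorant_eq_integral, intervalIntegral.integral_of_le zero_le_one]
  exact (integrable_const _).add (integrable_majorantKernel hρ hT x).integral_prod_right

lemma intervalIntegrable_prawitzWeight_mul_charFun (hρ : Integrable id ρ) {T : ℝ} (hT : 0 < T)
    (x : ℝ) : IntervalIntegrable (fun t => (prawitzWeight t
      * Complex.exp (-(T * t * x : ℝ) * Complex.I) * charFun ρ (T * t)).re) volume 0 1 := by
  simp_rw [← integral_majorantKernel]
  rw [intervalIntegrable_iff_integrableOn_Ioc_of_le zero_le_one]
  exact (integrable_majorantKernel hρ hT x).integral_prod_left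

lemma integral_beurlingMajorant_comp (hρ : Integrable id ρ) {T : ℝ} (hT : 0 < T) (x : ℝ) :
    ∫ v, beurlingMajorant (T * (v - x) / (2 * π)) ∂ρ
      = 1 / 2 + ∫ t in (0 : ℝ)..1, (prawitzWeight t
          * Complex.exp (-(T * t * x : ℝ) * Complex.I) * charFun ρ (T * t)).re := by
  have hi := integrable_majorantKernel hρ hT x
  simp_rw [← integral_majorantKernel, beurlingMajorant_eq_integral,
    intervalIntegral.integral_of_le zero_le_one]
  rw [integral_add (integrable_const _) hi.integral_prod_right,
    integral_integral_swap (f := fun v t => majorantKernel T x (t, v)) hi.swap]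
  simp

end Smoothing

lemma gaussianPDFReal_zero_one_le (x : ℝ) : gaussianPDFReal 0 1 x ≤ (√(2 * π))⁻¹ := by
  rw [gaussianPDFReal]
  simp only [NNReal.coe_one, mul_one]
  refine mul_le_of_le_one_right (by positivity) (Real.exp_le_one_iff.2 ?_)
  have : 0 ≤ (x - 0) ^ 2 := sq_nonneg _
  linarith

lemma integrable_beurlingExcess_comp {T : ℝ} (hT : 0 < T) (x : ℝ) :
    Integrable (fun v => beurlingExcess (T * (v - x) / (2 * π))) := by
  have h := (integrable_beurlingExcess.comp_mul_left'
    (R := T / (2 * π)) (by have := Real.pi_pos; positivity)).comp_sub_right x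
  refine h.congr (ae_of_all _ fun v => ?_)
  simp only
  congr 1; ring

lemma integral_beurlingExcess_gaussian_le {T : ℝ} (hT : 0 < T) (x : ℝ) :
    ∫ v, beurlingExcess (T * (v - x) / (2 * π)) ∂(gaussianReal 0 1) ≤ √(π / 2) / T := by
  have hpi := Real.pi_pos
  have hi := integrable_beurlingExcess_comp hT x
  rw [integral_gaussianReal_eq_integral_smul one_ne_zero]
  calc ∫ v, gaussianPDFReal 0 1 v • beurlingExcess (T * (v - x) / (2 * π))
      ≤ ∫ v, (√(2 * π))⁻¹ * beurlingExcess (T * (v - x) / (2 * π)) := by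
        refine integral_mono_of_nonneg (ae_of_all _ fun v => ?_) (hi.const_mul _)
          (ae_of_all _ fun v => ?_)
        · exact mul_nonneg (gaussianPDFReal_nonneg _ _ _) (beurlingExcess_nonneg _)
        · exact mul_le_mul_of_nonneg_right (gaussianPDFReal_zero_one_le v)
            (beurlingExcess_nonneg _)
    _ = (√(2 * π))⁻¹ * (2 * π / T * ∫ y, beurlingExcess y) := by
        rw [integral_const_mul,
          integral_sub_right_eq_self (fun v => beurlingExcess (T * v / (2 * π))) x]
        congr 1
        have := Measure.integral_comp_mul_left beurlingExcess (T / (2 * π))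
        rw [abs_of_pos (by positivity), inv_div, smul_eq_mul] at this
        rw [← this]
        congr 1; ext v; congr 1; ring
    _ ≤ (√(2 * π))⁻¹ * (2 * π / T * (1 / 2)) := by
        gcongr; exact integral_beurlingExcess_le
    _ = √(π / 2) / T := by
        have h1 : √(2 * π) = 2 * √(π / 2) := by
          rw [show 2 * π = 2 ^ 2 * (π / 2) by ring, Real.sqrt_mul (by norm_num),
            Real.sqrt_sq (by norm_num)]
        have h2 : √(π / 2) * √(π / 2) = π / 2 := Real.mul_self_sqrt (by positivity)
        have h3 : 0 < √(π / 2) := by positivity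
        rw [h1]; field_simp
        nlinarith

lemma integrable_id_gaussianReal : Integrable id (gaussianReal 0 1) :=
  (memLp_id_gaussianReal (μ := 0) (v := 1) 1).integrable (by simp)

lemma beurlingMajorant_comp_eq {T : ℝ} (hT : 0 < T) (x v : ℝ) :
    beurlingMajorant (T * (v - x) / (2 * π))
      = (Set.Ici x).indicator 1 v + beurlingExcess (T * (v - x) / (2 * π)) := by
  have hpi := Real.pi_pos
  have h : (Set.Ici (0 : ℝ)).indicator (1 : ℝ → ℝ) (T * (v - x) / (2 * π))
      = (Set.Ici x).indicator 1 v := by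
    have : T * (v - x) / (2 * π) ∈ Set.Ici (0 : ℝ) ↔ v ∈ Set.Ici x := by
      simp only [Set.mem_Ici]
      constructor
      · intro h
        have h' := (le_div_iff₀ (by positivity)).1 h
        rw [zero_mul] at h'
        linarith [nonneg_of_mul_nonneg_right h' hT]
      · intro h
        exact div_nonneg (mul_nonneg hT.le (by linarith)) (by positivity)
    by_cases hv : v ∈ Set.Ici x
    · rw [Set.indicator_of_mem hv, Set.indicator_of_mem (this.2 hv)]; rfl
    · rw [Set.indicator_of_notMem hv, Set.indicator_of_notMem (mt this.1 hv)]
  rw [beurlingExcess, h]; ring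

/-- One-sided smoothing inequality with the Beurling majorant. -/
theorem measureReal_Ici_le_of_charFun {ρ : Measure ℝ} [IsProbabilityMeasure ρ]
    (hρ : Integrable id ρ) {T : ℝ} (hT : 0 < T) {b : ℝ → ℝ}
    (hb : IntervalIntegrable b volume 0 T)
    (h : ∀ s, 0 < s → s ≤ T → ‖charFun ρ s - charFun (gaussianReal 0 1) s‖ ≤ s * b s) (x : ℝ) :
    ρ.real (Set.Ici x) ≤ (gaussianReal 0 1).real (Set.Ici x) + √(π / 2) / T
      + 1.05 / π * ∫ s in (0 : ℝ)..T, b s := by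
  have hpi := Real.pi_pos
  set γ := gaussianReal 0 1
  have hγ : Integrable id γ := integrable_id_gaussianReal
  have i1 : ρ.real (Set.Ici x) ≤ ∫ v, beurlingMajorant (T * (v - x) / (2 * π)) ∂ρ := by
    rw [← integral_indicator_one measurableSet_Ici]
    refine integral_mono ((integrable_const (1 : ℝ)).indicator measurableSet_Ici)
      (integrable_beurlingMajorant_comp hρ hT x) fun v => ?_
    simp only
    rw [beurlingMajorant_comp_eq hT]
    exact le_add_of_nonneg_right (beurlingExcess_nonneg _)
  have i2 : ∫ v, beurlingMajorant (T * (v - x) / (2 * π)) ∂γ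
      ≤ γ.real (Set.Ici x) + √(π / 2) / T := by
    have hind : Integrable ((Set.Ici x).indicator (1 : ℝ → ℝ)) γ :=
      (integrable_const (1 : ℝ)).indicator measurableSet_Ici
    have hex : Integrable (fun v => beurlingExcess (T * (v - x) / (2 * π))) γ := by
      refine ((integrable_beurlingMajorant_comp hγ hT x).sub hind).congr (ae_of_all _ fun v => ?_)
      simp only [Pi.sub_apply]
      rw [beurlingMajorant_comp_eq hT]; ring
    simp_rw [beurlingMajorant_comp_eq hT]
    rw [integral_add hind hex, integral_indicator_one measurableSet_Ici]
    gcongr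
    exact integral_beurlingExcess_gaussian_le hT x
  have i3 : ∫ v, beurlingMajorant (T * (v - x) / (2 * π)) ∂ρ
      - ∫ v, beurlingMajorant (T * (v - x) / (2 * π)) ∂γ ≤ 1.05 / π * ∫ s in (0 : ℝ)..T, b s := by
    rw [integral_beurlingMajorant_comp hρ hT, integral_beurlingMajorant_comp hγ hT,
      add_sub_add_left_eq_sub, ← intervalIntegral.integral_sub
      (intervalIntegrable_prawitzWeight_mul_charFun hρ hT x)
      (intervalIntegrable_prawitzWeight_mul_charFun hγ hT x)]
    have hbT : IntervalIntegrable (fun t => b (T * t)) volume 0 1 := by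
      have := hb.comp_mul_left (c := T)
      simpa [hT.ne'] using this
    have hcv : ∫ s in (0 : ℝ)..T, b s = T * ∫ t in (0 : ℝ)..1, b (T * t) := by
      have := intervalIntegral.mul_integral_comp_mul_left (f := b) (a := 0) (b := 1) T
      rw [this]; simp
    rw [hcv, ← mul_assoc, ← intervalIntegral.integral_const_mul]
    refine intervalIntegral.integral_mono_on_of_le_Ioo zero_le_one
      ((intervalIntegrable_prawitzWeight_mul_charFun hρ hT x).sub
        (intervalIntegrable_prawitzWeight_mul_charFun hγ hT x)) (hbT.const_mul _) fun t ht => ?_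
    rw [← Complex.sub_re, ← mul_sub]
    refine (Complex.re_le_norm _).trans ?_
    rw [norm_mul, norm_mul, ← Complex.ofReal_neg, Complex.norm_exp_ofReal_mul_I, mul_one]
    calc _ ≤ 1.05 / π / t * (T * t * b (T * t)) :=
          mul_le_mul (norm_prawitzWeight_le ht.1 ht.2.le)
            (h _ (mul_pos hT ht.1) (by nlinarith [ht.2])) (norm_nonneg _)
            (div_nonneg (by positivity) ht.1.le)
      _ = _ := by have := ht.1.ne'; field_simp
  linarith

lemma charFun_map_neg_real (ρ : Measure ℝ) (s : ℝ) :
    charFun (ρ.map Neg.neg) s = starRingEnd ℂ (charFun ρ s) := by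
  rw [← charFun_neg, charFun_apply_real, charFun_apply_real,
    integral_map measurable_neg.aemeasurable (by fun_prop)]
  congr 1; ext v; congr 1; push_cast; ring

/-- Two-sided smoothing inequality against the standard normal law. -/
theorem abs_measureReal_Iic_sub_gaussian_le {ρ : Measure ℝ} [IsProbabilityMeasure ρ]
    (hρ : Integrable id ρ) {T : ℝ} (hT : 0 < T) {b : ℝ → ℝ}
    (hb : IntervalIntegrable b volume 0 T)
    (h : ∀ s, 0 < s → s ≤ T → ‖charFun ρ s - charFun (gaussianReal 0 1) s‖ ≤ s * b s) (x : ℝ) :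
    |ρ.real (Set.Iic x) - (gaussianReal 0 1).real (Set.Iic x)| ≤ √(π / 2) / T
      + 1.05 / π * ∫ s in (0 : ℝ)..T, b s := by
  set γ := gaussianReal 0 1 with hγdef
  have hγneg : γ.map Neg.neg = γ := by
    have := gaussianReal_map_neg (μ := 0) (v := 1)
    rw [neg_zero] at this
    exact this
  have hneg : ∀ (ν : Measure ℝ), (ν.map Neg.neg).real (Set.Ici (-x)) = ν.real (Set.Iic x) := by
    intro ν
    rw [map_measureReal_apply measurable_neg measurableSet_Ici]
    congr 1; ext; simp
  have hIio : ∀ (ν : Measure ℝ) [IsProbabilityMeasure ν],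
      ν.real (Set.Iio x) = 1 - ν.real (Set.Ici x) := by
    intro ν _
    rw [← Set.compl_Ici, probReal_compl_eq_one_sub measurableSet_Ici]
  have : IsProbabilityMeasure (ρ.map Neg.neg) :=
    Measure.isProbabilityMeasure_map measurable_neg.aemeasurable
  have hup := measureReal_Ici_le_of_charFun (ρ := ρ.map Neg.neg) (b := b) (T := T)
    ((integrable_map_measure (by fun_prop) measurable_neg.aemeasurable).2 hρ.neg) hT hb
    (fun s h0 h1 => by
      rw [← hγdef, ← hγneg, charFun_map_neg_real, charFun_map_neg_real, ← map_sub,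
        RCLike.norm_conj]
      exact h s h0 h1) (-x)
  have hlo := measureReal_Ici_le_of_charFun hρ hT hb h x
  rw [hneg] at hup
  have hγx : γ.real (Set.Ici (-x)) = γ.real (Set.Iic x) := by rw [← hneg, hγneg]
  have : NullSingletonClass γ := nullSingletonClass_gaussianReal one_ne_zero
  have hγI : γ.real (Set.Iio x) = γ.real (Set.Iic x) :=
    measureReal_congr Iio_ae_eq_Iic
  have hρI : ρ.real (Set.Iio x) ≤ ρ.real (Set.Iic x) := measureReal_mono Set.Iio_subset_Iic_self
  rw [hIio] at hγI hρI
  rw [abs_le]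
  constructor <;> linarith

lemma cos_le_one_sub_sq_add_cube {y : ℝ} (hy : 0 ≤ y) :
    Real.cos y ≤ 1 - y ^ 2 / 2 + y ^ 3 / 10 := by
  rcases le_total y 2.4 with h | h
  · have hmono : MonotoneOn (fun u => 1 - u ^ 2 / 2 + u ^ 4 / 24 - Real.cos u) (Set.Ici 0) := by
      refine monotoneOn_of_hasDerivWithinAt_nonneg
        (f' := fun u => -u + u ^ 3 / 6 + Real.sin u)
        (convex_Ici 0) (by fun_prop) (fun v _ => ?_) (fun v hv => ?_)
      · refine ((((((hasDerivAt_id v).pow 2).div_const 2).const_sub 1).add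
          (((hasDerivAt_id v).pow 4).div_const 24)).sub
          (Real.hasDerivAt_cos v)).congr_deriv ?_ |>.hasDerivWithinAt
        simp
        ring
      · rw [interior_Ici] at hv
        have := Real.sin_ge_sub_cube (le_of_lt hv)
        linarith
    have h1 := hmono Set.self_mem_Ici hy hy
    norm_num at h1
    have : y ^ 4 / 24 ≤ y ^ 3 / 10 := by
      have : 0 ≤ y ^ 3 * (2.4 - y) := mul_nonneg (by positivity) (by linarith)
      nlinarith
    linarith
  · have h1 := Real.one_sub_sq_div_two_le_cos (x := y - π)
    rw [Real.cos_sub_pi] at h1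
    have h2 := Real.pi_gt_d4
    have h3 := Real.pi_lt_d4
    have h4 : 3.1415 * y - 3.1415 ^ 2 / 2 - 0.001 ≤ π * y - π ^ 2 / 2 := by
      nlinarith
    have h5 : 0 ≤ (y - 4.13) ^ 2 * (y - 1.74) := mul_nonneg (sq_nonneg _) (by linarith)
    nlinarith

lemma norm_exp_I_mul_sub_one_sub_le {y : ℝ} (hy : 0 ≤ y) :
    ‖Complex.exp (Complex.I * y) - 1 - Complex.I * y‖ ≤ y ^ 2 / 2 := by
  have hd : ∀ v : ℝ, HasDerivAt (fun u : ℝ => Complex.exp (Complex.I * u) - 1 - Complex.I * u)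
      (Complex.I * (Complex.exp (Complex.I * v) - 1)) v := by
    intro v
    have h := ((hasDerivAt_id v).ofReal_comp.const_mul Complex.I)
    refine ((h.cexp.sub_const 1).sub h).congr_deriv ?_
    simp
    ring
  have hB : ∀ v : ℝ, HasDerivAt (fun u : ℝ => u ^ 2 / 2) v v := by
    intro v
    refine (((hasDerivAt_id v).pow 2).div_const 2).congr_deriv ?_
    simp
  exact image_norm_le_of_norm_deriv_right_le_deriv_boundary (a := 0) (b := y)
    (fun v _ => (hd v).continuousAt.continuousWithinAt) (fun v _ => (hd v).hasDerivWithinAt)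
    (by simp) hB (fun v hv => by
      rw [norm_mul, Complex.norm_I, one_mul]
      simpa [abs_of_nonneg hv.1] using Real.norm_exp_I_mul_ofReal_sub_one_le (x := v))
    ⟨hy, le_rfl⟩

lemma norm_exp_I_mul_sub_one_sub_add_le {y : ℝ} (hy : 0 ≤ y) :
    ‖Complex.exp (Complex.I * y) - 1 - Complex.I * y + y ^ 2 / 2‖ ≤ y ^ 3 / 6 := by
  have hd : ∀ v : ℝ, HasDerivAt
      (fun u : ℝ => Complex.exp (Complex.I * u) - 1 - Complex.I * u + (u : ℂ) ^ 2 / 2)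
      (Complex.I * (Complex.exp (Complex.I * v) - 1 - Complex.I * v)) v := by
    intro v
    have h0 := (hasDerivAt_id v).ofReal_comp
    have h := h0.const_mul Complex.I
    refine (((h.cexp.sub_const 1).sub h).add ((h0.pow 2).div_const 2)).congr_deriv ?_
    simp only [id, Complex.ofReal_one]
    linear_combination (v : ℂ) * Complex.I_sq
  have hB : ∀ v : ℝ, HasDerivAt (fun u : ℝ => u ^ 3 / 6) (v ^ 2 / 2) v := by
    intro v
    refine (((hasDerivAt_id v).pow 3).div_const 6).congr_deriv ?_
    simp
    ring
  exact image_norm_le_of_norm_deriv_right_le_deriv_boundary (a := 0) (b := y)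
    (fun v _ => (hd v).continuousAt.continuousWithinAt) (fun v _ => (hd v).hasDerivWithinAt)
    (by simp) hB (fun v hv => by
      rw [norm_mul, Complex.norm_I, one_mul]
      exact norm_exp_I_mul_sub_one_sub_le hv.1)
    ⟨hy, le_rfl⟩

lemma norm_exp_sub_one_le_mul_of_re_le {z : ℂ} {r : ℝ} (hr : 0 < r) (hz : z.re ≤ r) :
    ‖Complex.exp z - 1‖ ≤ ‖z‖ * ((Real.exp r - 1) / r) := by
  have hd : ∀ v : ℝ, HasDerivAt (fun u : ℝ => Complex.exp (u * z) - 1)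
      (z * Complex.exp (v * z)) v := by
    intro v
    have h := ((hasDerivAt_id v).ofReal_comp.mul_const z)
    refine (h.cexp.sub_const 1).congr_deriv ?_
    simp
    ring
  have hB : ∀ v : ℝ, HasDerivAt (fun u : ℝ => ‖z‖ * ((Real.exp (u * r) - 1) / r))
      (‖z‖ * Real.exp (v * r)) v := by
    intro v
    have h := ((hasDerivAt_id v).mul_const r)
    refine (((h.exp.sub_const 1).div_const r).const_mul ‖z‖).congr_deriv ?_
    simp [hr.ne']
  have := image_norm_le_of_norm_deriv_right_le_deriv_boundary (a := 0) (b := 1)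
    (fun v _ => (hd v).continuousAt.continuousWithinAt) (fun v _ => (hd v).hasDerivWithinAt)
    (by simp) hB (fun v hv => by
      rw [norm_mul, Complex.norm_exp]
      gcongr
      simpa using mul_le_mul_of_nonneg_left hz hv.1)
    (x := 1) ⟨zero_le_one, le_rfl⟩
  simpa using this

lemma exp_mul_sub_one_le {θ x : ℝ} (h0 : 0 ≤ θ) (h1 : θ ≤ 1) (hx : 0 ≤ x) :
    Real.exp (θ * x) - 1 ≤ θ * x * (1 - θ) + θ ^ 2 * (Real.exp x - 1) := by
  have hmono : MonotoneOn (fun u => θ * u * (1 - θ) + θ ^ 2 * (Real.exp u - 1)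
      - (Real.exp (θ * u) - 1)) (Set.Ici 0) := by
    refine monotoneOn_of_hasDerivWithinAt_nonneg
      (f' := fun u => θ * ((1 - θ) + θ * Real.exp u - Real.exp (θ * u)))
      (convex_Ici 0) (by fun_prop) (fun v _ => ?_) (fun v hv => ?_)
    · have h := (hasDerivAt_id v).const_mul θ
      refine (((h.mul_const (1 - θ)).add (((Real.hasDerivAt_exp v).sub_const 1).const_mul
        (θ ^ 2))).sub (h.exp.sub_const 1)).congr_deriv ?_ |>.hasDerivWithinAt
      simp
      ring
    · have := convexOn_exp.2 (Set.mem_univ 0) (Set.mem_univ v) (sub_nonneg.2 h1) h0 (by ring)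
      simp only [smul_eq_mul, mul_zero, zero_add, Real.exp_zero, mul_one] at this
      exact mul_nonneg h0 (sub_nonneg.2 this)
  have := hmono Set.self_mem_Ici hx hx
  simp only [mul_zero, zero_mul, Real.exp_zero, sub_self, add_zero] at this
  linarith

section PoissonExponent

variable {E : Type*} [MeasurableSpace E] {ν : Measure E} {X : E → ℝ}

lemma integrable_cexp_sub_one_sub (hm : AEStronglyMeasurable X ν)
    (h2 : Integrable (fun e => X e ^ 2) ν)
    (hX : ∀ᵐ e ∂ν, 0 ≤ X e) {s : ℝ} (hs : 0 ≤ s) :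
    Integrable (fun e => Complex.exp (Complex.I * (s * X e : ℝ)) - 1
      - Complex.I * (s * X e : ℝ)) ν := by
  refine Integrable.mono' ((h2.const_mul (s ^ 2)).div_const 2) (by fun_prop) ?_
  filter_upwards [hX] with e he
  refine (norm_exp_I_mul_sub_one_sub_le (mul_nonneg hs he)).trans_eq ?_
  ring

/-- Comparison of a centred compound Poisson characteristic function with the Gaussian one. -/
lemma norm_exp_integral_sub_gaussian_le (hm : AEStronglyMeasurable X ν)
    (h2 : Integrable (fun e => X e ^ 2) ν) (h3 : Integrable (fun e => X e ^ 3) ν)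
    (hX : ∀ᵐ e ∂ν, 0 ≤ X e) (hvar : ∫ e, X e ^ 2 ∂ν = 1) {L : ℝ} (hL : 0 < L)
    (hL3 : ∫ e, X e ^ 3 ∂ν = L) {s : ℝ} (hs : 0 < s) :
    ‖Complex.exp (∫ e, (Complex.exp (Complex.I * (s * X e : ℝ)) - 1
        - Complex.I * (s * X e : ℝ)) ∂ν) - Complex.exp (-s ^ 2 / 2 : ℝ)‖
      ≤ 1 / 0.6 * Real.exp (-s ^ 2 / 2) * (Real.exp (0.1 * L * s ^ 3) - 1) := by
  set ψ := ∫ e, (Complex.exp (Complex.I * (s * X e : ℝ)) - 1 - Complex.I * (s * X e : ℝ)) ∂ν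
  have hi := integrable_cexp_sub_one_sub hm h2 hX hs.le
  have hi2 : Integrable (fun e => (((s * X e : ℝ) : ℂ) ^ 2 / 2)) ν := by
    refine ((h2.const_mul (s ^ 2 / 2)).ofReal (𝕜 := ℂ)).congr (ae_of_all _ fun e => ?_)
    change ((s ^ 2 / 2 * X e ^ 2 : ℝ) : ℂ) = _
    push_cast
    ring
  have hz : ψ + (s ^ 2 / 2 : ℝ) = ∫ e, (Complex.exp (Complex.I * (s * X e : ℝ)) - 1
      - Complex.I * (s * X e : ℝ) + ((s * X e : ℝ) : ℂ) ^ 2 / 2) ∂ν := by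
    rw [integral_add hi hi2]
    congr 1
    have : ∀ e, ((s * X e : ℝ) : ℂ) ^ 2 / 2 = ((s ^ 2 / 2 * X e ^ 2 : ℝ) : ℂ) := by
      intro e; push_cast; ring
    simp_rw [this]
    rw [integral_complex_ofReal, integral_const_mul, hvar, mul_one]
  set z := ψ + (s ^ 2 / 2 : ℝ)
  have hnorm : ‖z‖ ≤ L * s ^ 3 / 6 := by
    rw [hz, ← hL3]
    calc _ ≤ ∫ e, s ^ 3 / 6 * X e ^ 3 ∂ν := by
          refine norm_integral_le_of_norm_le (h3.const_mul _) ?_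
          filter_upwards [hX] with e he
          refine (norm_exp_I_mul_sub_one_sub_add_le (mul_nonneg hs.le he)).trans_eq ?_
          ring
      _ = _ := by rw [integral_const_mul]; ring
  have hre : z.re ≤ 0.1 * L * s ^ 3 := by
    have h := integral_re (𝕜 := ℂ) (hi.add hi2)
    rw [hz]
    refine (h.symm.le.trans ?_ : _)
    rw [← hL3]
    calc _ ≤ ∫ e, 0.1 * s ^ 3 * X e ^ 3 ∂ν := by
          refine integral_mono_ae (hi.add hi2).re (h3.const_mul _) ?_
          filter_upwards [hX] with e he
          have h := cos_le_one_sub_sq_add_cube (mul_nonneg hs.le he)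
          have e1 : (Complex.exp (Complex.I * (s * X e : ℝ))).re = Real.cos (s * X e) := by
            rw [mul_comm, Complex.exp_ofReal_mul_I_re]
          have e2 : (((s * X e : ℝ) : ℂ) ^ 2 / 2).re = (s * X e) ^ 2 / 2 := by
            rw [← Complex.ofReal_pow, ← Complex.ofReal_ofNat, ← Complex.ofReal_div,
              Complex.ofReal_re]
          have e3 : (Complex.I * (s * X e : ℝ)).re = 0 := by simp
          simp only [Pi.add_apply, RCLike.re_to_complex, Complex.add_re, Complex.sub_re, e1, e2,
            e3, Complex.one_re]
          linarith [mul_pow s (X e) 3]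
      _ = _ := by rw [integral_const_mul]; ring
  have hr : 0 < 0.1 * L * s ^ 3 := by positivity
  have hexp : Complex.exp ψ - Complex.exp (-s ^ 2 / 2 : ℝ)
      = Complex.exp (-s ^ 2 / 2 : ℝ) * (Complex.exp z - 1) := by
    rw [mul_sub, ← Complex.exp_add, mul_one]
    congr 2
    simp only [z]
    push_cast
    ring
  rw [hexp, norm_mul, ← Complex.ofReal_exp, Complex.norm_real, Real.norm_eq_abs, Real.abs_exp]
  calc _ ≤ Real.exp (-s ^ 2 / 2) * (L * s ^ 3 / 6
        * ((Real.exp (0.1 * L * s ^ 3) - 1) / (0.1 * L * s ^ 3))) := by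
        gcongr
        refine (norm_exp_sub_one_le_mul_of_re_le hr hre).trans ?_
        gcongr
        exact div_nonneg (by linarith [Real.add_one_le_exp (0.1 * L * s ^ 3)]) hr.le
    _ = _ := by field_simp; ring

end PoissonExponent

/-- The bound for the characteristic function difference, divided by the frequency. -/
noncomputable def charFunErrorBound (L s : ℝ) : ℝ :=
  1 / 0.6 * (0.1 * L * (s ^ 2 * Real.exp (-s ^ 2 / 2))
    - 0.025 * L ^ 2 * (s ^ 3 * Real.exp (-s ^ 2 / 2))
    + L ^ 2 / 16 * (s * (Real.exp (-(0.1 * s ^ 2)) - Real.exp (-s ^ 2 / 2))))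

lemma continuous_charFunErrorBound (L : ℝ) : Continuous (charFunErrorBound L) := by
  unfold charFunErrorBound
  fun_prop

lemma gaussian_mul_exp_sub_one_le {L s : ℝ} (hL : 0 < L) (hs : 0 < s) (hsT : s ≤ 4 / L) :
    1 / 0.6 * Real.exp (-s ^ 2 / 2) * (Real.exp (0.1 * L * s ^ 3) - 1)
      ≤ s * charFunErrorBound L s := by
  have hθ : L * s / 4 ≤ 1 := by
    rw [le_div_iff₀ hL] at hsT
    linarith
  have h := exp_mul_sub_one_le (θ := L * s / 4) (x := 0.4 * s ^ 2) (by positivity) hθ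
    (by positivity)
  have e1 : L * s / 4 * (0.4 * s ^ 2) = 0.1 * L * s ^ 3 := by ring
  rw [e1] at h
  have e2 : Real.exp (-(0.1 * s ^ 2)) = Real.exp (-s ^ 2 / 2) * Real.exp (0.4 * s ^ 2) := by
    rw [← Real.exp_add]; congr 1; ring
  rw [charFunErrorBound, e2]
  calc _ ≤ 1 / 0.6 * Real.exp (-s ^ 2 / 2) * (0.1 * L * s ^ 3 * (1 - L * s / 4)
        + (L * s / 4) ^ 2 * (Real.exp (0.4 * s ^ 2) - 1)) := by gcongr
    _ = _ := by ring

lemma intervalIntegral_gaussian_le {T : ℝ} (hT : 0 ≤ T) :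
    ∫ s in (0 : ℝ)..T, Real.exp (-s ^ 2 / 2) ≤ √(π / 2) := by
  have h := integral_gaussian_Ioi (1 / 2)
  have e : ∀ s : ℝ, Real.exp (-(1 / 2) * s ^ 2) = Real.exp (-s ^ 2 / 2) := by
    intro s; congr 1; ring
  simp_rw [e] at h
  have h_int : Integrable (fun s : ℝ => Real.exp (-s ^ 2 / 2)) := by
    have := integrable_exp_neg_mul_sq (b := 1 / 2) (by norm_num)
    simp_rw [e] at this
    exact this
  rw [intervalIntegral.integral_of_le hT]
  refine (setIntegral_mono_set h_int.integrableOn (ae_of_all _ fun s => (Real.exp_pos _).le)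
    Set.Ioc_subset_Ioi_self.eventuallyLE).trans_eq ?_
  rw [h, show π / (1 / 2) = 2 ^ 2 * (π / 2) by ring, Real.sqrt_mul (by norm_num),
    Real.sqrt_sq (by norm_num)]
  ring

lemma intervalIntegral_charFunErrorBound_le {L T : ℝ} (hL : 0 < L) (hT : 0 ≤ T) :
    ∫ s in (0 : ℝ)..T, charFunErrorBound L s
      ≤ 1 / 0.6 * (0.1 * L * √(π / 2)
        - 0.025 * L ^ 2 * (2 - (T ^ 2 + 2) * Real.exp (-T ^ 2 / 2))
        + L ^ 2 / 16 * (5 * (1 - Real.exp (-(0.1 * T ^ 2))) - (1 - Real.exp (-T ^ 2 / 2)))) := by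
  set F : ℝ → ℝ := fun s => 1 / 0.6 * (-0.1 * L * (s * Real.exp (-s ^ 2 / 2))
    + 0.025 * L ^ 2 * ((s ^ 2 + 2) * Real.exp (-s ^ 2 / 2))
    + L ^ 2 / 16 * (-5 * Real.exp (-(0.1 * s ^ 2)) + Real.exp (-s ^ 2 / 2))) with hF
  have hd : ∀ s, HasDerivAt F (charFunErrorBound L s
      - 1 / 0.6 * (0.1 * L) * Real.exp (-s ^ 2 / 2)) s := by
    intro s
    have h1 : HasDerivAt (fun s : ℝ => Real.exp (-s ^ 2 / 2)) (Real.exp (-s ^ 2 / 2) * (-s)) s := by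
      refine (((hasDerivAt_id s).pow 2).neg.div_const 2).exp.congr_deriv ?_
      simp
      ring
    have h2 : HasDerivAt (fun s : ℝ => Real.exp (-(0.1 * s ^ 2)))
        (Real.exp (-(0.1 * s ^ 2)) * (-0.2 * s)) s := by
      refine (((hasDerivAt_id s).pow 2).const_mul 0.1).neg.exp.congr_deriv ?_
      simp only [id, Nat.cast_ofNat, Nat.add_one_sub_one, pow_one, Pi.neg_apply, Pi.pow_apply]
      ring
    refine ((((((hasDerivAt_id s).mul h1).const_mul (-0.1 * L)).add
      (((((hasDerivAt_id s).pow 2).add_const 2).mul h1).const_mul (0.025 * L ^ 2))).add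
      (((h2.const_mul (-5)).add h1).const_mul (L ^ 2 / 16))).const_mul
      (1 / 0.6)).congr_deriv ?_
    simp only [id, charFunErrorBound, Nat.cast_ofNat, Nat.add_one_sub_one, pow_one, Pi.pow_apply]
    ring
  have hcont : Continuous fun s : ℝ => 1 / 0.6 * (0.1 * L) * Real.exp (-s ^ 2 / 2) := by fun_prop
  have hdiff : Continuous fun s : ℝ => charFunErrorBound L s
      - 1 / 0.6 * (0.1 * L) * Real.exp (-s ^ 2 / 2) := (continuous_charFunErrorBound L).sub hcont
  have h_int : ∫ s in (0 : ℝ)..T, charFunErrorBound L s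
      = F T - F 0 + 1 / 0.6 * (0.1 * L) * ∫ s in (0 : ℝ)..T, Real.exp (-s ^ 2 / 2) := by
    rw [← intervalIntegral.integral_eq_sub_of_hasDerivAt (fun s _ => hd s)
      (hdiff.intervalIntegrable _ _),
      ← intervalIntegral.integral_const_mul, ← intervalIntegral.integral_add
      (hdiff.intervalIntegrable _ _)
      (hcont.intervalIntegrable _ _)]
    simp
  have hg := mul_le_mul_of_nonneg_left (intervalIntegral_gaussian_le hT)
    (show 0 ≤ 1 / 0.6 * (0.1 * L) by positivity)
  have hTe : 0 ≤ 1 / 0.6 * (0.1 * L * (T * Real.exp (-T ^ 2 / 2))) := by positivity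
  have hF0 : F 0 = 1 / 0.6 * (0.05 * L ^ 2 - L ^ 2 / 4) := by
    simp only [hF]
    norm_num
    ring
  rw [h_int, hF0]
  simp only [hF]
  linarith

lemma add_one_mul_exp_neg_le {x : ℝ} (hx : 0 ≤ x) :
    (x + 1) * Real.exp (-x) ≤ 6 / (6 + x ^ 2) := by
  have h := Real.sum_le_exp_of_nonneg hx 4
  simp only [Finset.sum_range_succ, Finset.sum_range_zero] at h
  norm_num [Nat.factorial] at h
  rw [Real.exp_neg, le_div_iff₀ (by positivity), ← div_eq_mul_inv, div_mul_eq_mul_div,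
    div_le_iff₀ (Real.exp_pos x)]
  nlinarith

lemma exp_neg_tangent_le (a u : ℝ) : Real.exp (-a) * (1 + a - u) ≤ Real.exp (-u) := by
  have h := Real.add_one_le_exp (a - u)
  calc _ ≤ Real.exp (-a) * Real.exp (a - u) := by
        gcongr; linarith
    _ = _ := by rw [← Real.exp_add]; congr 1; ring

/-- Numerical estimate behind the constant in the Berry-Esseen bound. -/
lemma berryEsseen_numeric {L : ℝ} (h0 : 0 < L) (h1 : L ≤ 2.1) :
    L * (2 - 3.125 * Real.exp (-(1.6 / L ^ 2)) + 0.5 * (8 / L ^ 2 + 1) * Real.exp (-(8 / L ^ 2))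
      + 0.625 * Real.exp (-(8 / L ^ 2))) ≤ 1.711 := by
  set x := 8 / L ^ 2 with hx
  set E := Real.exp (-(1.6 / L ^ 2)) with hE
  have hE0 : 0 ≤ E := (Real.exp_pos _).le
  have hx0 : 0 ≤ x := by positivity
  have hLx : L ^ 2 * x = 8 := by rw [hx]; field_simp
  have hx1 : 1.81 ≤ x := by
    rw [hx, le_div_iff₀ (by positivity)]; nlinarith
  have hq := add_one_mul_exp_neg_le hx0
  have hq0 := Real.exp_pos (-x)
  generalize Real.exp (-x) = q at *
  have hq2 : 0.5 * (x + 1) * q + 0.625 * q ≤ 4.38 / (6 + x ^ 2) := by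
    have : 4.38 / (6 + x ^ 2) = 0.73 * (6 / (6 + x ^ 2)) := by ring
    rw [this]
    nlinarith
  have key : ∀ {A B : ℝ}, A ≤ 3.125 * E → 4.38 / (6 + x ^ 2) ≤ B → L * (2 - A + B) ≤ 1.711 →
      L * (2 - 3.125 * E + 0.5 * (x + 1) * q + 0.625 * q) ≤ 1.711 := by
    intro A B hA hB h
    refine le_trans (mul_le_mul_of_nonneg_left ?_ h0.le) h
    linarith
  have hfrac : ∀ {c B : ℝ}, 0 ≤ c → c ≤ x → 0 ≤ B → 4.38 ≤ B * (6 + c ^ 2) →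
      4.38 / (6 + x ^ 2) ≤ B := by
    intro c B hc hcx hB h
    rw [div_le_iff₀ (by positivity)]
    refine h.trans ?_
    gcongr
  have he1 : (0.36787 : ℝ) ≤ Real.exp (-1) := by
    have := Real.exp_neg_one_gt_d9; linarith
  have hLi : 0 < 1.6 / L ^ 2 := by positivity
  rcases le_total L 0.8 with h | h
  · have hx2 : 12.5 ≤ x := by
      rw [hx, le_div_iff₀ (by positivity)]; nlinarith
    exact key (A := 0) (B := 0.03) (by positivity)
      (hfrac (by norm_num) hx2 (by norm_num) (by norm_num)) (by linarith)
  rcases le_total L 1.3 with h' | h'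
  · have hx2 : 4.73 ≤ x := by
      rw [hx, le_div_iff₀ (by positivity)]; nlinarith
    have he2 : (0.1353 : ℝ) ≤ Real.exp (-2) := by
      have : Real.exp (-2) = Real.exp (-1) * Real.exp (-1) := by rw [← Real.exp_add]; norm_num
      rw [this]; nlinarith
    have ht := exp_neg_tangent_le 2 (1.6 / L ^ 2)
    have hu : 1.6 / L ^ 2 ≤ 2.5 := by rw [div_le_iff₀ (by positivity)]; nlinarith
    have hA : 3.125 * (0.1353 * (3 - 1.6 / L ^ 2)) ≤ 3.125 * E := by
      refine mul_le_mul_of_nonneg_left (le_trans ?_ ht) (by norm_num)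
      norm_num
      exact mul_le_mul_of_nonneg_right (by linarith) (by linarith)
    refine key hA (B := 0.155) (hfrac (by norm_num) hx2 (by norm_num) (by norm_num)) ?_
    have : L * (2 - 3.125 * (0.1353 * (3 - 1.6 / L ^ 2)) + 0.155)
        = (2 - 3.125 * 0.1353 * 3 + 0.155) * L + 3.125 * 0.1353 * 1.6 / L := by
      field_simp; ring
    rw [this, ← le_sub_iff_add_le', div_le_iff₀ h0]
    nlinarith
  · have hu : 1.6 / L ^ 2 ≤ 1 := by rw [div_le_iff₀ (by positivity)]; nlinarith
    have ht := exp_neg_tangent_le 1 (1.6 / L ^ 2)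
    have hA : 3.125 * (0.36787 * (2 - 1.6 / L ^ 2)) ≤ 3.125 * E := by
      refine mul_le_mul_of_nonneg_left (le_trans ?_ ht) (by norm_num)
      norm_num
      exact mul_le_mul_of_nonneg_right (by linarith) (by linarith)
    refine key hA (B := 0.48) (hfrac (by norm_num) hx1 (by norm_num) (by norm_num)) ?_
    have : L * (2 - 3.125 * (0.36787 * (2 - 1.6 / L ^ 2)) + 0.48)
        = (2 - 3.125 * 0.36787 * 2 + 0.48) * L + 3.125 * 0.36787 * 1.6 / L := by
      field_simp; ring
    rw [this, ← le_sub_iff_add_le', div_le_iff₀ h0]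
    nlinarith

/-- A Berry-Esseen bound for centred and normalized compound Poisson type laws. -/
theorem abs_measureReal_Iic_sub_gaussian_le_of_charFun {E : Type*} [MeasurableSpace E]
    {ν : Measure E} {X : E → ℝ} (hm : AEStronglyMeasurable X ν)
    (h2 : Integrable (fun e => X e ^ 2) ν) (h3 : Integrable (fun e => X e ^ 3) ν)
    (hX : ∀ᵐ e ∂ν, 0 ≤ X e) (hvar : ∫ e, X e ^ 2 ∂ν = 1)
    {ρ : Measure ℝ} [IsProbabilityMeasure ρ] (hρ : Integrable id ρ)
    (hcf : ∀ s, 0 < s → charFun ρ s = Complex.exp (∫ e, (Complex.exp (Complex.I * (s * X e : ℝ))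
      - 1 - Complex.I * (s * X e : ℝ)) ∂ν)) (x : ℝ) :
    |ρ.real (Set.Iic x) - (gaussianReal 0 1).real (Set.Iic x)| ≤ 0.4785 * ∫ e, X e ^ 3 ∂ν := by
  set L := ∫ e, X e ^ 3 ∂ν with hLdef
  have hX3 : 0 ≤ᵐ[ν] fun e => X e ^ 3 := hX.mono fun e he => pow_nonneg he 3
  have hL : 0 < L := by
    refine (integral_nonneg_of_ae hX3).lt_of_ne fun h => ?_
    have h' := (integral_eq_zero_iff_of_nonneg_ae hX3 h3).1 h.symm
    have : ∫ e, X e ^ 2 ∂ν = 0 := by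
      rw [integral_eq_zero_of_ae]
      filter_upwards [h'] with e he
      simpa using he
    linarith
  have htriv : |ρ.real (Set.Iic x) - (gaussianReal 0 1).real (Set.Iic x)| ≤ 1 := by
    rw [abs_le]
    constructor <;>
    linarith [measureReal_nonneg (μ := ρ) (s := Set.Iic x),
      measureReal_nonneg (μ := gaussianReal 0 1) (s := Set.Iic x),
      measureReal_le_one (μ := ρ) (s := Set.Iic x),
      measureReal_le_one (μ := gaussianReal 0 1) (s := Set.Iic x)]
  rcases le_total 2.1 L with hL2 | hL2
  · linarith
  have hsmooth := abs_measureReal_Iic_sub_gaussian_le hρ (T := 4 / L) (by positivity)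
    ((continuous_charFunErrorBound L).intervalIntegrable _ _) (fun s hs0 hs1 => by
      have hg : charFun (gaussianReal 0 1) s = Complex.exp (-s ^ 2 / 2 : ℝ) := by
        rw [charFun_gaussianReal]; congr 1; push_cast; ring
      rw [hcf s hs0, hg]
      exact (norm_exp_integral_sub_gaussian_le hm h2 h3 hX hvar hL hLdef.symm hs0).trans
        (gaussian_mul_exp_sub_one_le hL hs0 hs1)) x
  refine hsmooth.trans ?_
  have h_int := intervalIntegral_charFunErrorBound_le hL (T := 4 / L) (by positivity)
  have hnum := berryEsseen_numeric hL hL2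
  have e1 : -(4 / L) ^ 2 / 2 = -(8 / L ^ 2) := by field_simp; norm_num
  have e2 : -(0.1 * (4 / L) ^ 2) = -(1.6 / L ^ 2) := by field_simp; norm_num
  have e3 : (4 / L) ^ 2 = 2 * (8 / L ^ 2) := by field_simp; norm_num
  rw [e1, e2, e3] at h_int
  have hsq : √(π / 2) ≤ 1.25332 := by
    rw [Real.sqrt_le_left (by norm_num)]
    linarith [Real.pi_lt_d6]
  have hpi : 1.05 / π ≤ 0.33423 := by
    rw [div_le_iff₀ Real.pi_pos]
    linarith [Real.pi_gt_d6]
  set q := Real.exp (-(8 / L ^ 2))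
  set E := Real.exp (-(1.6 / L ^ 2))
  have hbound : ∫ s in (0 : ℝ)..(4 / L), charFunErrorBound L s ≤ L / 6 * (1.25332 + 1.711) := by
    refine h_int.trans ?_
    calc _ = L / 6 * (√(π / 2) + L * (2 - 3.125 * E + 0.5 * (8 / L ^ 2 + 1) * q + 0.625 * q)) := by
          ring
      _ ≤ _ := by gcongr
  have e4 : √(π / 2) / (4 / L) ≤ L * 1.25332 / 4 := by
    rw [div_div_eq_mul_div, mul_comm]
    gcongr
  have e5 : 1.05 / π * ∫ s in (0 : ℝ)..(4 / L), charFunErrorBound L s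
      ≤ 0.33423 * (L / 6 * (1.25332 + 1.711)) :=
    (mul_le_mul_of_nonneg_left hbound (by have := Real.pi_pos; positivity)).trans
      (mul_le_mul_of_nonneg_right hpi (by positivity))
  linarith

lemma exp_neg_le_quadratic {u : ℝ} (hu : 0 ≤ u) : Real.exp (-u) ≤ 1 - u + u ^ 2 / 2 := by
  have hmono : MonotoneOn (fun u => 1 - u + u ^ 2 / 2 - Real.exp (-u)) (Set.Ici 0) := by
    refine monotoneOn_of_hasDerivWithinAt_nonneg (f' := fun u => Real.exp (-u) - (-u + 1))
      (convex_Ici 0) (by fun_prop) (fun v _ => ?_) (fun v _ => ?_)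
    · refine ((((hasDerivAt_id v).const_sub 1).add (((hasDerivAt_id v).pow 2).div_const 2)).sub
        (hasDerivAt_id v).neg.exp).congr_deriv ?_ |>.hasDerivWithinAt
      simp
      ring
    · linarith [Real.add_one_le_exp (-v)]
  have := hmono Set.self_mem_Ici hu hu
  norm_num at this
  linarith

lemma cubic_le_exp_neg {u : ℝ} (hu : 0 ≤ u) :
    1 - u + u ^ 2 / 2 - u ^ 3 / 6 ≤ Real.exp (-u) := by
  have hmono : MonotoneOn (fun u => Real.exp (-u) - (1 - u + u ^ 2 / 2 - u ^ 3 / 6))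
      (Set.Ici 0) := by
    refine monotoneOn_of_hasDerivWithinAt_nonneg
      (f' := fun u => 1 - u + u ^ 2 / 2 - Real.exp (-u))
      (convex_Ici 0) (by fun_prop) (fun v _ => ?_) (fun v hv => ?_)
    · refine ((hasDerivAt_id v).neg.exp.sub
        ((((hasDerivAt_id v).const_sub 1).add (((hasDerivAt_id v).pow 2).div_const 2)).sub
        (((hasDerivAt_id v).pow 3).div_const 6))).congr_deriv ?_ |>.hasDerivWithinAt
      simp
      ring
    · rw [interior_Ici] at hv
      linarith [exp_neg_le_quadratic (le_of_lt hv)]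
  have := hmono Set.self_mem_Ici hu hu
  norm_num at this
  linarith

lemma one_sub_exp_neg_div_mem {s z : ℝ} (hs : 0 < s) (hz : 0 ≤ z) :
    (1 - Real.exp (-(s * z))) / s ∈ Set.Icc (z - s * z ^ 2 / 2) z := by
  have h1 := Real.add_one_le_exp (-(s * z))
  have h2 := exp_neg_le_quadratic (mul_nonneg hs.le hz)
  rw [Set.mem_Icc, le_div_iff₀ hs, div_le_iff₀ hs]
  constructor <;> nlinarith

lemma exp_neg_sub_one_add_div_mem {s z : ℝ} (hs : 0 < s) (hz : 0 ≤ z) :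
    2 * (Real.exp (-(s * z)) - 1 + s * z) / s ^ 2 ∈ Set.Icc (z ^ 2 - s * z ^ 3 / 3) (z ^ 2) := by
  have h1 := cubic_le_exp_neg (mul_nonneg hs.le hz)
  have h2 := exp_neg_le_quadratic (mul_nonneg hs.le hz)
  rw [Set.mem_Icc, le_div_iff₀ (by positivity), div_le_iff₀ (by positivity)]
  constructor <;> nlinarith

lemma tendsto_sub_mul_nhdsGT_zero (a c : ℝ) :
    Tendsto (fun s : ℝ => a - s * c) (𝓝[>] 0) (𝓝 a) := by
  have : Tendsto (fun s : ℝ => a - s * c) (𝓝 0) (𝓝 (a - 0 * c)) :=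
    (by fun_prop : Continuous fun s : ℝ => a - s * c).tendsto 0
  rw [zero_mul, sub_zero] at this
  exact this.mono_left nhdsWithin_le_nhds

lemma tendsto_one_sub_exp_neg_div {z : ℝ} (hz : 0 ≤ z) :
    Tendsto (fun s => (1 - Real.exp (-(s * z))) / s) (𝓝[>] 0) (𝓝 z) := by
  refine tendsto_of_tendsto_of_tendsto_of_le_of_le' (tendsto_sub_mul_nhdsGT_zero z (z ^ 2 / 2))
    tendsto_const_nhds ?_ ?_ <;> filter_upwards [self_mem_nhdsWithin] with s hs
  · rw [← mul_div_assoc]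
    exact (one_sub_exp_neg_div_mem hs hz).1
  · exact (one_sub_exp_neg_div_mem hs hz).2

lemma tendsto_exp_neg_sub_one_add_div {z : ℝ} (hz : 0 ≤ z) :
    Tendsto (fun s => 2 * (Real.exp (-(s * z)) - 1 + s * z) / s ^ 2) (𝓝[>] 0) (𝓝 (z ^ 2)) := by
  refine tendsto_of_tendsto_of_tendsto_of_le_of_le'
    (tendsto_sub_mul_nhdsGT_zero (z ^ 2) (z ^ 3 / 3))
    tendsto_const_nhds ?_ ?_ <;> filter_upwards [self_mem_nhdsWithin] with s hs
  · rw [← mul_div_assoc]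
    exact (exp_neg_sub_one_add_div_mem hs hz).1
  · exact (exp_neg_sub_one_add_div_mem hs hz).2

section LaplaceMoments

variable {E : Type*} [MeasurableSpace E] {ν : Measure E} {X : E → ℝ}

lemma one_sub_exp_neg_nonneg {u : ℝ} (hu : 0 ≤ u) : 0 ≤ 1 - Real.exp (-u) :=
  sub_nonneg.2 (Real.exp_le_one_iff.2 (neg_nonpos.2 hu))

lemma one_sub_exp_neg_div_nonneg {s z : ℝ} (hs : 0 < s) (hz : 0 ≤ z) :
    0 ≤ (1 - Real.exp (-(s * z))) / s :=
  div_nonneg (one_sub_exp_neg_nonneg (mul_nonneg hs.le hz)) hs.le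

lemma exp_neg_sub_one_add_div_nonneg (s z : ℝ) :
    0 ≤ 2 * (Real.exp (-(s * z)) - 1 + s * z) / s ^ 2 :=
  div_nonneg (by linarith [Real.add_one_le_exp (-(s * z))]) (sq_nonneg s)

lemma tendsto_integral_one_sub_exp_neg_div (hX : ∀ᵐ e ∂ν, 0 ≤ X e) (h1 : Integrable X ν) :
    Tendsto (fun s => ∫ e, (1 - Real.exp (-(s * X e))) / s ∂ν) (𝓝[>] 0) (𝓝 (∫ e, X e ∂ν)) := by
  have hm := h1.aestronglyMeasurable
  refine tendsto_integral_filter_of_dominated_convergence X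
    (Eventually.of_forall fun s => by fun_prop) ?_ h1 ?_
  · filter_upwards [self_mem_nhdsWithin] with s hs
    filter_upwards [hX] with e he
    rw [Real.norm_of_nonneg (one_sub_exp_neg_div_nonneg hs he)]
    exact (one_sub_exp_neg_div_mem hs he).2
  · filter_upwards [hX] with e he
    exact tendsto_one_sub_exp_neg_div he

lemma tendsto_integral_exp_neg_sub_one_add_div (hX : ∀ᵐ e ∂ν, 0 ≤ X e)
    (hm : AEStronglyMeasurable X ν) (h2 : Integrable (fun e => X e ^ 2) ν) :
    Tendsto (fun s => ∫ e, 2 * (Real.exp (-(s * X e)) - 1 + s * X e) / s ^ 2 ∂ν) (𝓝[>] 0)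
      (𝓝 (∫ e, X e ^ 2 ∂ν)) := by
  refine tendsto_integral_filter_of_dominated_convergence (fun e => X e ^ 2)
    (Eventually.of_forall fun s => by fun_prop) ?_ h2 ?_
  · filter_upwards [self_mem_nhdsWithin] with s hs
    filter_upwards [hX] with e he
    rw [Real.norm_of_nonneg (exp_neg_sub_one_add_div_nonneg _ _)]
    exact (exp_neg_sub_one_add_div_mem hs he).2
  · filter_upwards [hX] with e he
    exact tendsto_exp_neg_sub_one_add_div he

lemma integrable_one_sub_exp_neg (hX : ∀ᵐ e ∂ν, 0 ≤ X e) (h1 : Integrable X ν) {s : ℝ}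
    (hs : 0 < s) : Integrable (fun e => 1 - Real.exp (-(s * X e))) ν := by
  have hm := h1.aestronglyMeasurable
  refine Integrable.mono' (h1.const_mul s) (by fun_prop) ?_
  filter_upwards [hX] with e he
  rw [Real.norm_of_nonneg (one_sub_exp_neg_nonneg (mul_nonneg hs.le he))]
  linarith [Real.add_one_le_exp (-(s * X e))]

/-- A limit of nonnegative functions with bounded integrals is integrable. -/
lemma integrable_of_tendsto_of_integral_le {F : ℕ → E → ℝ} {f : E → ℝ} {C : ℝ}
    (hF : ∀ n, Integrable (F n) ν) (hF0 : ∀ n, 0 ≤ᵐ[ν] F n) (hf0 : 0 ≤ᵐ[ν] f)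
    (hf : AEStronglyMeasurable f ν)
    (hlim : ∀ᵐ e ∂ν, Tendsto (fun n => F n e) atTop (𝓝 (f e)))
    (hC : ∀ n, ∫ e, F n e ∂ν ≤ C) : Integrable f ν := by
  refine ⟨hf, ?_⟩
  rw [hasFiniteIntegral_iff_ofReal hf0]
  calc ∫⁻ e, ENNReal.ofReal (f e) ∂ν
      = ∫⁻ e, liminf (fun n => ENNReal.ofReal (F n e)) atTop ∂ν := by
        refine lintegral_congr_ae ?_
        filter_upwards [hlim] with e he
        exact ((ENNReal.continuous_ofReal.tendsto _).comp he).liminf_eq.symm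
    _ ≤ liminf (fun n => ∫⁻ e, ENNReal.ofReal (F n e) ∂ν) atTop :=
        lintegral_liminf_le' fun n => (hF n).aemeasurable.ennreal_ofReal
    _ ≤ ENNReal.ofReal C := by
        refine liminf_le_of_le (by isBoundedDefault) fun b hb => ?_
        obtain ⟨n, hn⟩ := hb.exists
        refine hn.trans ?_
        rw [← ofReal_integral_eq_lintegral_ofReal (hF n) (hF0 n)]
        exact ENNReal.ofReal_le_ofReal (hC n)
    _ < ⊤ := ENNReal.ofReal_lt_top

variable {Ω : Type*} [MeasurableSpace Ω] {μ : Measure Ω} [IsProbabilityMeasure μ] {W : Ω → ℝ}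

/-- The Laplace transform of `W` is that of a Poisson sum with intensity `ν` and marks `X`. -/
def HasPoissonLaplace (W : Ω → ℝ) (μ : Measure Ω) (X : E → ℝ) (ν : Measure E) : Prop :=
  ∀ s : ℝ, 0 < s → ∫ ω, Real.exp (-(s * W ω)) ∂μ = Real.exp (-∫ e, (1 - Real.exp (-(s * X e))) ∂ν)

lemma integral_one_sub_exp_neg_bounds (hX : ∀ᵐ e ∂ν, 0 ≤ X e) (h1 : Integrable X ν) {s : ℝ}
    (hs : 0 < s) :
    0 ≤ ∫ e, (1 - Real.exp (-(s * X e))) ∂ν ∧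
      ∫ e, (1 - Real.exp (-(s * X e))) ∂ν ≤ s * ∫ e, X e ∂ν := by
  constructor
  · refine integral_nonneg_of_ae ?_
    filter_upwards [hX] with e he
    exact one_sub_exp_neg_nonneg (mul_nonneg hs.le he)
  · rw [← integral_const_mul]
    refine integral_mono_ae (integrable_one_sub_exp_neg hX h1 hs) (h1.const_mul s) ?_
    exact ae_of_all _ fun e => by linarith [Real.add_one_le_exp (-(s * X e))]

lemma integrable_exp_neg_mul (hW : ∀ ω, 0 ≤ W ω) (hWm : Measurable W) {s : ℝ} (hs : 0 < s) :
    Integrable (fun ω => Real.exp (-(s * W ω))) μ := by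
  refine Integrable.of_bound (C := 1) (by fun_prop) (ae_of_all _ fun ω => ?_)
  rw [Real.norm_of_nonneg (Real.exp_pos _).le, Real.exp_le_one_iff, neg_nonpos]
  exact mul_nonneg hs.le (hW ω)

lemma tendsto_one_div_nat_nhdsGT_zero : Tendsto (fun n : ℕ => 1 / ((n : ℝ) + 1)) atTop (𝓝[>] 0) :=
  tendsto_nhdsWithin_iff.2 ⟨tendsto_one_div_add_atTop_nhds_zero_nat,
    Eventually.of_forall fun n => Set.mem_Ioi.2 (by positivity)⟩

namespace HasPoissonLaplace

lemma integral_one_sub_div (h : HasPoissonLaplace W μ X ν) (hW : ∀ ω, 0 ≤ W ω)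
    (hWm : Measurable W) {s : ℝ} (hs : 0 < s) :
    ∫ ω, (1 - Real.exp (-(s * W ω))) / s ∂μ
      = (1 - Real.exp (-∫ e, (1 - Real.exp (-(s * X e))) ∂ν)) / s := by
  rw [integral_div, integral_sub (integrable_const _) (integrable_exp_neg_mul hW hWm hs), h s hs]
  simp

lemma integrable (h : HasPoissonLaplace W μ X ν) (hW : ∀ ω, 0 ≤ W ω) (hWm : Measurable W)
    (hX : ∀ᵐ e ∂ν, 0 ≤ X e) (h1 : Integrable X ν) : Integrable W μ := by
  refine integrable_of_tendsto_of_integral_le (C := ∫ e, X e ∂ν)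
    (F := fun n ω => (1 - Real.exp (-(1 / ((n : ℝ) + 1) * W ω))) / (1 / ((n : ℝ) + 1)))
    (fun n => ?_) (fun n => ae_of_all _ fun ω => ?_) (ae_of_all _ hW) hWm.aestronglyMeasurable
    (ae_of_all _ fun ω => ?_) (fun n => ?_)
  · exact ((integrable_const 1).sub (integrable_exp_neg_mul hW hWm (by positivity))).div_const _
  · exact one_sub_exp_neg_div_nonneg (by positivity) (hW ω)
  · exact (tendsto_one_sub_exp_neg_div (hW ω)).comp tendsto_one_div_nat_nhdsGT_zero
  · have hs : (0 : ℝ) < 1 / ((n : ℝ) + 1) := by positivity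
    generalize 1 / ((n : ℝ) + 1) = s at *
    rw [h.integral_one_sub_div hW hWm hs, div_le_iff₀ hs]
    have hb := (integral_one_sub_exp_neg_bounds hX h1 hs).2
    linarith [Real.add_one_le_exp (-∫ e, (1 - Real.exp (-(s * X e))) ∂ν)]

lemma tendsto_exponent_div (hX : ∀ᵐ e ∂ν, 0 ≤ X e) (h1 : Integrable X ν) :
    Tendsto (fun s => (∫ e, (1 - Real.exp (-(s * X e))) ∂ν) / s) (𝓝[>] 0) (𝓝 (∫ e, X e ∂ν)) := by
  simp_rw [← integral_div]
  exact tendsto_integral_one_sub_exp_neg_div hX h1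

lemma tendsto_id_nhdsGT_zero : Tendsto (fun s : ℝ => s) (𝓝[>] 0) (𝓝 0) :=
  tendsto_id.mono_left nhdsWithin_le_nhds

lemma integral_eq (h : HasPoissonLaplace W μ X ν) (hW : ∀ ω, 0 ≤ W ω) (hWm : Measurable W)
    (hX : ∀ᵐ e ∂ν, 0 ≤ X e) (h1 : Integrable X ν) : ∫ ω, W ω ∂μ = ∫ e, X e ∂ν := by
  have hWi := h.integrable hW hWm hX h1
  have hlim := tendsto_integral_one_sub_exp_neg_div (ae_of_all _ hW) hWi
  have hΛ := tendsto_exponent_div hX h1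
  refine tendsto_nhds_unique hlim (tendsto_of_tendsto_of_tendsto_of_le_of_le'
    (g := fun s => (∫ e, (1 - Real.exp (-(s * X e))) ∂ν) / s
      - s * ((∫ e, (1 - Real.exp (-(s * X e))) ∂ν) / s) ^ 2 / 2) ?_ hΛ ?_ ?_)
  · have := hΛ.sub ((tendsto_id_nhdsGT_zero.mul (hΛ.pow 2)).div_const 2)
    simpa using this
  all_goals
    filter_upwards [self_mem_nhdsWithin] with s hs
    have hs' : 0 < s := hs
    rw [h.integral_one_sub_div hW hWm hs]
    have h0 := (integral_one_sub_exp_neg_bounds hX h1 hs).1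
    generalize ∫ e, (1 - Real.exp (-(s * X e))) ∂ν = Λ at *
  · have := exp_neg_le_quadratic h0
    rw [le_div_iff₀ hs']
    field_simp
    linarith
  · have := Real.add_one_le_exp (-Λ)
    gcongr
    linarith

lemma integral_exp_neg_sub_one_add_div (h : HasPoissonLaplace W μ X ν) (hW : ∀ ω, 0 ≤ W ω)
    (hWm : Measurable W) (hX : ∀ᵐ e ∂ν, 0 ≤ X e) (h1 : Integrable X ν) {s : ℝ} (hs : 0 < s) :
    ∫ ω, 2 * (Real.exp (-(s * W ω)) - 1 + s * W ω) / s ^ 2 ∂μ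
      = 2 * (Real.exp (-∫ e, (1 - Real.exp (-(s * X e))) ∂ν) - 1 + s * ∫ e, X e ∂ν) / s ^ 2 := by
  have hexp := integrable_exp_neg_mul (μ := μ) hW hWm hs
  have hexp1 : Integrable (fun ω => Real.exp (-(s * W ω)) - 1) μ :=
    hexp.sub (integrable_const 1)
  rw [integral_div, integral_const_mul, integral_add hexp1
    ((h.integrable hW hWm hX h1).const_mul s), integral_sub hexp (integrable_const 1), h s hs,
    integral_const_mul, h.integral_eq hW hWm hX h1]
  simp

lemma integrable_sq (h : HasPoissonLaplace W μ X ν) (hW : ∀ ω, 0 ≤ W ω) (hWm : Measurable W)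
    (hX : ∀ᵐ e ∂ν, 0 ≤ X e) (h1 : Integrable X ν) (h2 : Integrable (fun e => X e ^ 2) ν) :
    Integrable (fun ω => W ω ^ 2) μ := by
  refine integrable_of_tendsto_of_integral_le (C := ∫ e, X e ^ 2 ∂ν + (∫ e, X e ∂ν) ^ 2)
    (F := fun n ω => 2 * (Real.exp (-(1 / ((n : ℝ) + 1) * W ω)) - 1 + 1 / ((n : ℝ) + 1) * W ω)
      / (1 / ((n : ℝ) + 1)) ^ 2)
    (fun n => ?_) (fun n => ae_of_all _ fun ω => ?_) (ae_of_all _ fun ω => sq_nonneg _)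
    (hWm.pow_const 2).aestronglyMeasurable (ae_of_all _ fun ω => ?_) (fun n => ?_)
  · exact ((((integrable_exp_neg_mul hW hWm (by positivity)).sub (integrable_const 1)).add
      ((h.integrable hW hWm hX h1).const_mul _)).const_mul 2).div_const _
  · exact exp_neg_sub_one_add_div_nonneg _ _
  · exact (tendsto_exp_neg_sub_one_add_div (hW ω)).comp tendsto_one_div_nat_nhdsGT_zero
  · have hs : (0 : ℝ) < 1 / ((n : ℝ) + 1) := by positivity
    generalize 1 / ((n : ℝ) + 1) = s at *
    rw [h.integral_exp_neg_sub_one_add_div hW hWm hX h1 hs, div_le_iff₀ (by positivity)]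
    have hb := integral_one_sub_exp_neg_bounds hX h1 hs
    have hlow : s * ∫ e, X e ∂ν - s ^ 2 / 2 * ∫ e, X e ^ 2 ∂ν
        ≤ ∫ e, (1 - Real.exp (-(s * X e))) ∂ν := by
      rw [← integral_const_mul, ← integral_const_mul,
        ← integral_sub (h1.const_mul s) (h2.const_mul _)]
      refine integral_mono_ae ((h1.const_mul s).sub (h2.const_mul _))
        (integrable_one_sub_exp_neg hX h1 hs) ?_
      filter_upwards [hX] with e he
      have := exp_neg_le_quadratic (mul_nonneg hs.le he)
      linarith [mul_pow s (X e) 2]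
    generalize ∫ e, (1 - Real.exp (-(s * X e))) ∂ν = Λ at *
    have hq := exp_neg_le_quadratic hb.1
    have hsq : Λ ^ 2 ≤ (s * ∫ e, X e ∂ν) ^ 2 := pow_le_pow_left₀ hb.1 hb.2 2
    linarith [mul_pow s (∫ e, X e ∂ν) 2]

lemma integral_sq_eq (h : HasPoissonLaplace W μ X ν) (hW : ∀ ω, 0 ≤ W ω) (hWm : Measurable W)
    (hX : ∀ᵐ e ∂ν, 0 ≤ X e) (h1 : Integrable X ν) (h2 : Integrable (fun e => X e ^ 2) ν) :
    ∫ ω, W ω ^ 2 ∂μ = ∫ e, X e ^ 2 ∂ν + (∫ e, X e ∂ν) ^ 2 := by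
  have hlim := tendsto_integral_exp_neg_sub_one_add_div (ae_of_all _ hW)
    hWm.aestronglyMeasurable (h.integrable_sq hW hWm hX h1 h2)
  have hΛ := tendsto_exponent_div hX h1
  have hΛ2 := tendsto_integral_exp_neg_sub_one_add_div hX h1.aestronglyMeasurable h2
  refine tendsto_nhds_unique hlim (tendsto_of_tendsto_of_tendsto_of_le_of_le'
    (g := fun s => ∫ e, 2 * (Real.exp (-(s * X e)) - 1 + s * X e) / s ^ 2 ∂ν
      + ((∫ e, (1 - Real.exp (-(s * X e))) ∂ν) / s) ^ 2
      - s * ((∫ e, (1 - Real.exp (-(s * X e))) ∂ν) / s) ^ 3 / 3)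
    (h := fun s => ∫ e, 2 * (Real.exp (-(s * X e)) - 1 + s * X e) / s ^ 2 ∂ν
      + ((∫ e, (1 - Real.exp (-(s * X e))) ∂ν) / s) ^ 2) ?_ (hΛ2.add (hΛ.pow 2)) ?_ ?_)
  · have := (hΛ2.add (hΛ.pow 2)).sub ((tendsto_id_nhdsGT_zero.mul (hΛ.pow 3)).div_const 3)
    simpa using this
  all_goals
    filter_upwards [self_mem_nhdsWithin] with s hs
    have hs' : 0 < s := hs
    rw [h.integral_exp_neg_sub_one_add_div hW hWm hX h1 hs]
    have e1 : ∫ e, 2 * (Real.exp (-(s * X e)) - 1 + s * X e) / s ^ 2 ∂ν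
        = 2 * (s * ∫ e, X e ∂ν - ∫ e, (1 - Real.exp (-(s * X e))) ∂ν) / s ^ 2 := by
      rw [← integral_const_mul s, ← integral_sub (h1.const_mul s)
        (integrable_one_sub_exp_neg hX h1 hs), ← integral_const_mul, ← integral_div]
      congr 1; ext e; ring
    rw [e1]
    have h0 := (integral_one_sub_exp_neg_bounds hX h1 hs).1
    generalize ∫ e, (1 - Real.exp (-(s * X e))) ∂ν = Λ at *
    generalize ∫ e, X e ∂ν = m at *
  · have := cubic_le_exp_neg h0
    rw [le_div_iff₀ (by positivity)]
    field_simp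
    linarith
  · have := exp_neg_le_quadratic h0
    rw [div_le_iff₀ (by positivity)]
    field_simp
    linarith

lemma variance_eq (h : HasPoissonLaplace W μ X ν) (hW : ∀ ω, 0 ≤ W ω) (hWm : Measurable W)
    (hX : ∀ᵐ e ∂ν, 0 ≤ X e) (h1 : Integrable X ν) (h2 : Integrable (fun e => X e ^ 2) ν) :
    variance W μ = ∫ e, X e ^ 2 ∂ν := by
  have hmem : MemLp W 2 μ :=
    (memLp_two_iff_integrable_sq hWm.aestronglyMeasurable).2 (h.integrable_sq hW hWm hX h1 h2)
  rw [variance_eq_sub hmem, h.integral_eq hW hWm hX h1]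
  have := h.integral_sq_eq hW hWm hX h1 h2
  simp only [Pi.pow_apply]
  rw [this]; ring

end HasPoissonLaplace

end LaplaceMoments

section AnalyticContinuation

variable {E : Type*} [MeasurableSpace E] {ν : Measure E} {X : E → ℝ}

/-- The exponent `∫ (exp (z X) - 1) dν` as a function on the left half-plane. -/
noncomputable def levyExponent (X : E → ℝ) (ν : Measure E) (z : ℂ) : ℂ :=
  ∫ e, (Complex.exp (z * X e) - 1) ∂ν

lemma norm_cexp_sub_one_le_of_re_nonpos {z : ℂ} (hz : z.re ≤ 0) : ‖Complex.exp z - 1‖ ≤ ‖z‖ := by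
  have hd : ∀ v : ℝ, HasDerivAt (fun u : ℝ => Complex.exp (u * z) - 1)
      (z * Complex.exp (v * z)) v := by
    intro v
    have h := ((hasDerivAt_id v).ofReal_comp.mul_const z)
    refine (h.cexp.sub_const 1).congr_deriv ?_
    simp
    ring
  have hB : ∀ v : ℝ, HasDerivAt (fun u : ℝ => ‖z‖ * u) ‖z‖ v := by
    intro v
    simpa using (hasDerivAt_id v).const_mul ‖z‖
  have := image_norm_le_of_norm_deriv_right_le_deriv_boundary (a := 0) (b := 1)
    (fun v _ => (hd v).continuousAt.continuousWithinAt) (fun v _ => (hd v).hasDerivWithinAt)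
    (by simp) hB (fun v hv => by
      rw [norm_mul, Complex.norm_exp]
      refine mul_le_of_le_one_right (norm_nonneg _) (Real.exp_le_one_iff.2 ?_)
      simpa using mul_nonpos_of_nonneg_of_nonpos hv.1 hz)
    (x := 1) ⟨zero_le_one, le_rfl⟩
  simpa using this

lemma norm_cexp_mul_sub_one_le {z : ℂ} (hz : z.re ≤ 0) {x : ℝ} (hx : 0 ≤ x) :
    ‖Complex.exp (z * x) - 1‖ ≤ ‖z‖ * x := by
  have h := norm_cexp_sub_one_le_of_re_nonpos (z := z * x) (by
    rw [Complex.re_mul_ofReal]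
    exact mul_nonpos_of_nonpos_of_nonneg hz hx)
  rwa [norm_mul, Complex.norm_real, Real.norm_of_nonneg hx] at h

lemma integrable_cexp_mul_sub_one (hX : ∀ᵐ e ∂ν, 0 ≤ X e) (h1 : Integrable X ν) {z : ℂ}
    (hz : z.re ≤ 0) : Integrable (fun e => Complex.exp (z * X e) - 1) ν := by
  have hm := h1.aestronglyMeasurable
  refine Integrable.mono' (h1.const_mul ‖z‖) (by fun_prop) ?_
  filter_upwards [hX] with e he
  exact norm_cexp_mul_sub_one_le hz he

lemma differentiableAt_levyExponent (hX : ∀ᵐ e ∂ν, 0 ≤ X e) (h1 : Integrable X ν) {z : ℂ}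
    (hz : z.re < 0) : DifferentiableAt ℂ (levyExponent X ν) z := by
  have hm := h1.aestronglyMeasurable
  have hs : {w : ℂ | w.re < 0} ∈ 𝓝 z :=
    (isOpen_lt Complex.continuous_re continuous_const).mem_nhds hz
  refine (hasDerivAt_integral_of_dominated_loc_of_deriv_le
    (F := fun w e => Complex.exp (w * X e) - 1)
    (F' := fun w e => Complex.exp (w * X e) * X e) (bound := X) hs
    (Eventually.of_forall fun w => by fun_prop)
    (integrable_cexp_mul_sub_one hX h1 hz.le) (by fun_prop) ?_ h1 ?_).2.differentiableAt
  · filter_upwards [hX] with e he w hw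
    rw [norm_mul, Complex.norm_exp, Complex.norm_real, Real.norm_of_nonneg he,
      Complex.re_mul_ofReal]
    exact mul_le_of_le_one_left he
      (Real.exp_le_one_iff.2 (mul_nonpos_of_nonpos_of_nonneg (le_of_lt hw) he))
  · refine ae_of_all _ fun e w _ => ?_
    have h := (hasDerivAt_id w).mul_const (X e : ℂ)
    refine (h.cexp.sub_const 1).congr_deriv ?_
    simp

lemma continuousWithinAt_levyExponent (hX : ∀ᵐ e ∂ν, 0 ≤ X e) (h1 : Integrable X ν) (z : ℂ) :
    ContinuousWithinAt (levyExponent X ν) {w | w.re ≤ 0} z := by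
  have hm := h1.aestronglyMeasurable
  refine tendsto_integral_filter_of_dominated_convergence (fun e => (‖z‖ + 1) * X e)
    (Eventually.of_forall fun w => by fun_prop) ?_ (h1.const_mul _) ?_
  · have hb : ∀ᶠ w in 𝓝[{w : ℂ | w.re ≤ 0}] z, ‖w‖ < ‖z‖ + 1 :=
      nhdsWithin_le_nhds ((continuous_norm.tendsto z).eventually_lt_const (lt_add_one _))
    filter_upwards [hb, self_mem_nhdsWithin] with w hw hw0
    filter_upwards [hX] with e he
    refine (norm_cexp_mul_sub_one_le hw0 he).trans ?_
    gcongr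
  · refine ae_of_all _ fun e => ?_
    have : Continuous fun w : ℂ => Complex.exp (w * X e) - 1 := by fun_prop
    exact (this.tendsto z).mono_left nhdsWithin_le_nhds

lemma levyExponent_neg_ofReal (s : ℝ) :
    levyExponent X ν (-s : ℝ) = ((-∫ e, (1 - Real.exp (-(s * X e))) ∂ν : ℝ) : ℂ) := by
  rw [← integral_neg, ← integral_complex_ofReal, levyExponent]
  congr 1; ext e; push_cast; ring_nf

variable {Ω : Type*} [MeasurableSpace Ω] {μ : Measure Ω} [IsProbabilityMeasure μ] {W : Ω → ℝ}

namespace HasPoissonLaplace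

lemma one_add_levyExponent (h : HasPoissonLaplace W μ X ν) (hW : ∀ ω, 0 ≤ W ω)
    (hWm : Measurable W) (hX : ∀ᵐ e ∂ν, 0 ≤ X e) (h1 : Integrable X ν) :
    Set.EqOn (fun z => 1 + levyExponent W μ z) (fun z => Complex.exp (levyExponent X ν z))
      {z : ℂ | z.re < 0} := by
  have hWi := h.integrable hW hWm hX h1
  have hU : IsOpen {z : ℂ | z.re < 0} := isOpen_lt Complex.continuous_re continuous_const
  have hpre : IsPreconnected {z : ℂ | z.re < 0} := (convex_halfSpace_re_lt 0).isPreconnected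
  have hf : DifferentiableOn ℂ (fun z => 1 + levyExponent W μ z) {z : ℂ | z.re < 0} :=
    fun z hz => ((differentiableAt_levyExponent (ae_of_all _ hW) hWi hz).const_add
      1).differentiableWithinAt
  have hg : DifferentiableOn ℂ (fun z => Complex.exp (levyExponent X ν z)) {z : ℂ | z.re < 0} :=
    fun z hz => (differentiableAt_levyExponent hX h1 hz).cexp.differentiableWithinAt
  refine (hf.analyticOnNhd hU).eqOn_of_preconnected_of_frequently_eq (hg.analyticOnNhd hU) hpre
    (z₀ := ((-1 : ℝ) : ℂ)) (by simp) ?_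
  have hseq : Tendsto (fun n : ℕ => ((-(1 + 1 / ((n : ℝ) + 1)) : ℝ) : ℂ)) atTop
      (𝓝[≠] ((-1 : ℝ) : ℂ)) := by
    refine tendsto_nhdsWithin_iff.2 ⟨?_, Eventually.of_forall fun n => ?_⟩
    · refine (Complex.continuous_ofReal.tendsto _).comp ?_
      have := (tendsto_one_div_add_atTop_nhds_zero_nat (𝕜 := ℝ)).const_add 1 |>.neg
      simpa using this
    · have : (0 : ℝ) < 1 / ((n : ℝ) + 1) := by positivity
      simp only [Set.mem_compl_iff, Set.mem_singleton_iff, Complex.ofReal_inj]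
      linarith
  refine hseq.frequently (Eventually.of_forall fun n => ?_).frequently
  have hs : (0 : ℝ) < 1 + 1 / ((n : ℝ) + 1) := by positivity
  generalize 1 + 1 / ((n : ℝ) + 1) = s at *
  rw [levyExponent_neg_ofReal, levyExponent_neg_ofReal, integral_sub (integrable_const _)
    (integrable_exp_neg_mul hW hWm hs), h s hs, ← Complex.ofReal_exp]
  simp

lemma one_add_levyExponent_boundary (h : HasPoissonLaplace W μ X ν) (hW : ∀ ω, 0 ≤ W ω)
    (hWm : Measurable W) (hX : ∀ᵐ e ∂ν, 0 ≤ X e) (h1 : Integrable X ν) (s : ℝ) :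
    1 + levyExponent W μ (Complex.I * s) = Complex.exp (levyExponent X ν (Complex.I * s)) := by
  have hWi := h.integrable hW hWm hX h1
  have hseq : Tendsto (fun n : ℕ => Complex.I * s - ((1 / ((n : ℝ) + 1) : ℝ) : ℂ)) atTop
      (𝓝[{w : ℂ | w.re ≤ 0}] (Complex.I * s)) := by
    refine tendsto_nhdsWithin_iff.2 ⟨?_, Eventually.of_forall fun n => ?_⟩
    · have := ((Complex.continuous_ofReal.tendsto _).comp
        (tendsto_one_div_add_atTop_nhds_zero_nat (𝕜 := ℝ))).const_sub (Complex.I * (s : ℂ))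
      simpa using this
    · have : (0 : ℝ) < 1 / ((n : ℝ) + 1) := by positivity
      simp only [Set.mem_ofPred_eq, Complex.sub_re, Complex.re_mul_ofReal, Complex.I_re,
        Complex.ofReal_re]
      linarith
  have hl := ((continuousWithinAt_levyExponent (ae_of_all _ hW) hWi
    (Complex.I * s)).tendsto.comp hseq).const_add 1
  have hr := (Complex.continuous_exp.tendsto _).comp
    ((continuousWithinAt_levyExponent hX h1 (Complex.I * s)).tendsto.comp hseq)
  refine tendsto_nhds_unique (hl.congr fun n => ?_) hr
  have : (0 : ℝ) < 1 / ((n : ℝ) + 1) := by positivity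
  refine h.one_add_levyExponent hW hWm hX h1 ?_
  simp only [Set.mem_ofPred_eq, Complex.sub_re, Complex.re_mul_ofReal, Complex.I_re,
    Complex.ofReal_re]
  linarith

lemma integral_cexp (h : HasPoissonLaplace W μ X ν) (hW : ∀ ω, 0 ≤ W ω)
    (hWm : Measurable W) (hX : ∀ᵐ e ∂ν, 0 ≤ X e) (h1 : Integrable X ν) (s : ℝ) :
    ∫ ω, Complex.exp (Complex.I * s * W ω) ∂μ = Complex.exp (levyExponent X ν (Complex.I * s)) := by
  rw [← h.one_add_levyExponent_boundary hW hWm hX h1 s]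
  have h_int : Integrable (fun ω => Complex.exp (Complex.I * s * W ω)) μ := by
    refine Integrable.of_bound (C := 1) (by fun_prop) (ae_of_all _ fun ω => ?_)
    rw [mul_assoc, mul_comm, ← Complex.ofReal_mul, Complex.norm_exp_ofReal_mul_I]
  rw [levyExponent, integral_sub h_int (integrable_const _)]
  simp

/-- Berry-Esseen bound for a Poisson sum with intensity `ν` and marks `X`. -/
theorem abs_measure_normalized_le_sub_le (h : HasPoissonLaplace W μ X ν) (hW : ∀ ω, 0 ≤ W ω)
    (hWm : Measurable W) (hX : ∀ᵐ e ∂ν, 0 ≤ X e) (h1 : Integrable X ν)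
    (h2 : Integrable (fun e => X e ^ 2) ν) (h3 : Integrable (fun e => X e ^ 3) ν)
    (hpos : 0 < ∫ e, X e ^ 2 ∂ν) (x : ℝ) :
    |(μ {ω | (W ω - ∫ ω', W ω' ∂μ) / √(variance W μ) ≤ x}).toReal
        - (gaussianReal 0 1).real (Set.Iic x)|
      ≤ 0.4785 * ((∫ e, X e ^ 3 ∂ν) / (∫ e, X e ^ 2 ∂ν) ^ (3 / 2 : ℝ)) := by
  rw [h.variance_eq hW hWm hX h1 h2, h.integral_eq hW hWm hX h1]
  have hWi := h.integrable hW hWm hX h1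
  set m := ∫ e, X e ∂ν with hm
  set V := ∫ e, X e ^ 2 ∂ν with hV
  set σ := √V with hσ
  have hσ0 : 0 < σ := Real.sqrt_pos.2 hpos
  have hσ2 : σ ^ 2 = V := Real.sq_sqrt hpos.le
  have hσ3 : V ^ (3 / 2 : ℝ) = σ ^ 3 := by
    rw [hσ, Real.sqrt_eq_rpow, ← Real.rpow_natCast, ← Real.rpow_mul hpos.le]
    norm_num
  set Y : Ω → ℝ := fun ω => (W ω - m) / σ with hY
  have hYm : Measurable Y := (hWm.sub_const m).div_const σ
  have : IsProbabilityMeasure (μ.map Y) := Measure.isProbabilityMeasure_map hYm.aemeasurable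
  have hset : (μ {ω | (W ω - m) / σ ≤ x}).toReal = (μ.map Y).real (Set.Iic x) := by
    rw [map_measureReal_apply hYm measurableSet_Iic]; rfl
  have h3' : ∫ e, (X e / σ) ^ 3 ∂ν = (∫ e, X e ^ 3 ∂ν) / σ ^ 3 := by
    simp_rw [div_pow]; rw [integral_div]
  rw [hset, hσ3, ← h3']
  refine abs_measureReal_Iic_sub_gaussian_le_of_charFun (X := fun e => X e / σ)
    (h1.div_const σ).aestronglyMeasurable ?_ ?_ ?_ ?_ ?_ ?_ x
  · simp_rw [div_pow]; exact h2.div_const _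
  · simp_rw [div_pow]; exact h3.div_const _
  · filter_upwards [hX] with e he
    exact div_nonneg he hσ0.le
  · simp_rw [div_pow]
    rw [integral_div, hσ2, div_self hpos.ne']
  · rw [integrable_map_measure (by fun_prop) hYm.aemeasurable]
    exact (hWi.sub (integrable_const m)).div_const σ
  · intro s hs
    rw [charFun_apply_real, integral_map hYm.aemeasurable (by fun_prop)]
    have e1 : ∀ ω, Complex.exp (s * Y ω * Complex.I)
        = Complex.exp (-(Complex.I * (s / σ : ℝ) * m))
          * Complex.exp (Complex.I * (s / σ : ℝ) * W ω) := by
      intro ω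
      rw [← Complex.exp_add]
      congr 1
      simp only [hY]
      push_cast
      ring
    simp_rw [e1]
    rw [integral_const_mul, h.integral_cexp hW hWm hX h1, ← Complex.exp_add, levyExponent]
    congr 1
    have e2 : Complex.I * (s / σ : ℝ) * m = ∫ e, Complex.I * (s / σ : ℝ) * X e ∂ν := by
      rw [integral_const_mul, integral_complex_ofReal]
    have hlin : Integrable (fun e => Complex.I * (s / σ : ℝ) * (X e : ℂ)) ν :=
      h1.ofReal.const_mul _
    rw [e2, neg_add_eq_sub, ← integral_sub (integrable_cexp_mul_sub_one hX h1 (by simp)) hlin]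
    congr 1; ext e
    have e3 : Complex.I * (s / σ : ℝ) * X e = Complex.I * ((s * (X e / σ) : ℝ) : ℂ) := by
      push_cast; ring
    rw [e3]

end HasPoissonLaplace

end AnalyticContinuation

section ShotNoise

/-- The measure on the positive half-line with density `f`. -/
noncomputable def halfLineMeasure (f : ℝ → ℝ) : Measure ℝ :=
  (volume.restrict (Set.Ioi 0)).withDensity fun t => ENNReal.ofReal (f t)

instance (f : ℝ → ℝ) : SFinite (halfLineMeasure f) := by
  unfold halfLineMeasure
  infer_instance

lemma integrable_halfLineMeasure {f : ℝ → ℝ} (hf : Measurable f) (hf0 : ∀ t, 0 ≤ f t)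
    {g : ℝ → ℝ} :
    Integrable g (halfLineMeasure f) ↔ IntegrableOn (fun t => g t * f t) (Set.Ioi 0) := by
  rw [halfLineMeasure, integrable_withDensity_iff hf.ennreal_ofReal
    (ae_of_all _ fun _ => ENNReal.ofReal_lt_top)]
  simp only [ENNReal.toReal_ofReal (hf0 _)]
  rfl

lemma integral_halfLineMeasure {f : ℝ → ℝ} (hf : Measurable f) (hf0 : ∀ t, 0 ≤ f t) (g : ℝ → ℝ) :
    ∫ t, g t ∂halfLineMeasure f = ∫ t in Set.Ioi (0 : ℝ), g t * f t := by
  rw [halfLineMeasure, integral_withDensity_eq_integral_toReal_smul hf.ennreal_ofReal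
    (ae_of_all _ fun _ => ENNReal.ofReal_lt_top)]
  simp only [ENNReal.toReal_ofReal (hf0 _), smul_eq_mul, mul_comm]

lemma ae_halfLineMeasure_pos (f : ℝ → ℝ) : ∀ᵐ t ∂halfLineMeasure f, 0 < t :=
  (withDensity_absolutelyContinuous _ _).ae_le (ae_restrict_mem measurableSet_Ioi)

lemma integrableOn_pathLoss_mul {α ε : ℝ} (hε : 0 < ε) {G p : ℝ → ℝ}
    (hG_meas : Measurable G) (hG_nonneg : ∀ t, 0 ≤ t → 0 ≤ G t)
    (hG_bdd : ∃ C : ℝ, ∀ t, 0 ≤ t → G t ≤ C)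
    (hG_tail : ∃ K > (0:ℝ), ∃ B > (0:ℝ), ∀ t ≥ B, G t ≤ K * t ^ (-α))
    (hp_meas : Measurable p) (hp_nonneg : ∀ t, 0 ≤ p t)
    (hp_loc : ∀ b : ℝ, IntegrableOn p (Set.Icc 0 b))
    (hp_bigO : ∃ C > (0:ℝ), ∃ B' > (0:ℝ), ∀ t ≥ B', p t ≤ C * t ^ (α - 1 - ε)) :
    IntegrableOn (fun t => G t * p t) (Set.Ioi 0) := by
  obtain ⟨C, hC⟩ := hG_bdd
  obtain ⟨K, hK, B, hB, hGK⟩ := hG_tail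
  obtain ⟨D, hD, B', hB', hpD⟩ := hp_bigO
  have hb : 0 < max B B' := lt_max_of_lt_left hB
  rw [← Set.Ioc_union_Ioi_eq_Ioi hb.le, integrableOn_union]
  constructor
  · refine Integrable.mono' (((hp_loc (max B B')).mono_set Set.Ioc_subset_Icc_self).const_mul C)
      (hG_meas.mul hp_meas).aestronglyMeasurable ?_
    filter_upwards [ae_restrict_mem measurableSet_Ioc] with t ht
    rw [Real.norm_of_nonneg (mul_nonneg (hG_nonneg t ht.1.le) (hp_nonneg t))]
    exact mul_le_mul_of_nonneg_right (hC t ht.1.le) (hp_nonneg t)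
  · refine Integrable.mono' ((integrableOn_Ioi_rpow_of_lt (a := -1 - ε) (by linarith) hb).const_mul
      (K * D)) (hG_meas.mul hp_meas).aestronglyMeasurable ?_
    filter_upwards [ae_restrict_mem measurableSet_Ioi] with t ht
    have ht' : max B B' ≤ t := le_of_lt ht
    have ht0 : 0 < t := hb.trans ht
    rw [Real.norm_of_nonneg (mul_nonneg (hG_nonneg t ht0.le) (hp_nonneg t))]
    calc G t * p t ≤ K * t ^ (-α) * (D * t ^ (α - 1 - ε)) :=
          mul_le_mul (hGK t ((le_max_left _ _).trans ht')) (hpD t ((le_max_right _ _).trans ht'))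
            (hp_nonneg t) (by positivity)
      _ = K * D * (t ^ (-α) * t ^ (α - 1 - ε)) := by ring
      _ = K * D * t ^ (-1 - ε) := by
          rw [← Real.rpow_add ht0]
          ring_nf

lemma integrableOn_pathLoss_pow_mul {G p : ℝ → ℝ} (hG_meas : Measurable G)
    (hG_nonneg : ∀ t, 0 ≤ t → 0 ≤ G t) (hG_bdd : ∃ C : ℝ, ∀ t, 0 ≤ t → G t ≤ C)
    (hp_meas : Measurable p) (hp_nonneg : ∀ t, 0 ≤ p t)
    (hGp : IntegrableOn (fun t => G t * p t) (Set.Ioi 0)) (n : ℕ) :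
    IntegrableOn (fun t => G t ^ (n + 1) * p t) (Set.Ioi 0) := by
  obtain ⟨C, hC⟩ := hG_bdd
  refine Integrable.mono' (hGp.const_mul (C ^ n))
    ((hG_meas.pow_const _).mul hp_meas).aestronglyMeasurable ?_
  filter_upwards [ae_restrict_mem measurableSet_Ioi] with t ht
  have hG := hG_nonneg t (le_of_lt ht)
  have hp := hp_nonneg t
  rw [Real.norm_of_nonneg (by positivity), pow_succ, mul_assoc]
  gcongr
  exact hC t (le_of_lt ht)

lemma integral_pow_mul_pos {q : ℝ → ℝ} (hq_nonneg : ∀ h, 0 ≤ q h)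
    (hq : ∫ h in Set.Ioi (0 : ℝ), q h ≠ 0) (n : ℕ)
    (hqn : IntegrableOn (fun h => h ^ n * q h) (Set.Ioi 0)) :
    0 < ∫ h in Set.Ioi (0 : ℝ), h ^ n * q h := by
  have hnn : 0 ≤ᵐ[volume.restrict (Set.Ioi (0 : ℝ))] fun h => h ^ n * q h := by
    filter_upwards [ae_restrict_mem measurableSet_Ioi] with h hh
    exact mul_nonneg (pow_nonneg (le_of_lt hh) n) (hq_nonneg h)
  refine lt_of_le_of_ne (integral_nonneg_of_ae hnn) fun h0 => hq ?_
  refine integral_eq_zero_of_ae ?_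
  filter_upwards [(integral_eq_zero_iff_of_nonneg_ae hnn hqn).1 h0.symm,
    ae_restrict_mem measurableSet_Ioi] with h hh hpos
  exact (mul_eq_zero.1 hh).resolve_left (pow_pos hpos n).ne'

lemma gaussianReal_real_Iic (x : ℝ) :
    (gaussianReal 0 1).real (Set.Iic x) =
      (∫ t in Set.Iic x, Real.exp (-t ^ 2 / 2)) / √(2 * π) := by
  rw [Measure.real, gaussianReal_apply_eq_integral _ one_ne_zero, ENNReal.toReal_ofReal
    (setIntegral_nonneg measurableSet_Iic fun t _ => gaussianPDFReal_nonneg _ _ _), div_eq_inv_mul,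
    ← integral_const_mul]
  simp [gaussianPDFReal]

lemma lyapunov_ratio_mul {lam P a b c d : ℝ} (hlam : 0 < lam) (hP : 0 < P) (hb : 0 ≤ b)
    (hd : 0 ≤ d) :
    lam * P ^ 3 * a * c / (lam * P ^ 2 * b * d) ^ (3 / 2 : ℝ) =
      a / b ^ (3 / 2 : ℝ) * (c / d ^ (3 / 2 : ℝ)) / √lam := by
  have hP2 : (P ^ 2) ^ (3 / 2 : ℝ) = P ^ 3 := by
    rw [← Real.rpow_natCast, ← Real.rpow_mul hP.le, ← Real.rpow_natCast]
    norm_num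
  have hlam2 : lam ^ (3 / 2 : ℝ) = lam * √lam := by
    rw [Real.sqrt_eq_rpow, show (3 / 2 : ℝ) = 1 + 1 / 2 by norm_num, Real.rpow_add hlam,
      Real.rpow_one]
  rw [Real.mul_rpow (by positivity) hd, Real.mul_rpow (by positivity) hb,
    Real.mul_rpow hlam.le (by positivity), hP2, hlam2]
  have : lam * P ^ 3 * a * c / (lam * √lam * P ^ 3 * b ^ (3 / 2 : ℝ) * d ^ (3 / 2 : ℝ)) =
      (lam * P ^ 3) * (a * c) / ((lam * P ^ 3) * (b ^ (3 / 2 : ℝ) * d ^ (3 / 2 : ℝ) * √lam)) := by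
    ring
  rw [this, mul_div_mul_left _ _ (by positivity), div_mul_div_comm, div_div]

end ShotNoise

end

theorem gaussian_approximation_uniform
    {α ε lam P : ℝ} (hα : 2 < α) (hε : 0 < ε) (hlam : 0 < lam) (hP : 0 < P)
    (G p q : ℝ → ℝ)
    (hG_meas : Measurable G)
    (hG_nonneg : ∀ t, 0 ≤ t → 0 ≤ G t)
    (hG_bdd : ∃ C : ℝ, ∀ t, 0 ≤ t → G t ≤ C)
    (hG_anti : AntitoneOn G (Set.Ici 0))
    (hG_tail : ∃ K > (0:ℝ), ∃ B > (0:ℝ), ∀ t ≥ B, G t ≤ K * t ^ (-α))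
    (hp_meas : Measurable p) (hp_nonneg : ∀ t, 0 ≤ p t)
    (hp_loc : ∀ b : ℝ, IntegrableOn p (Set.Icc 0 b))
    (hp_top : ∫⁻ t in Set.Ioi (0:ℝ), ENNReal.ofReal (p t) = ⊤)
    (hp_bigO : ∃ C > (0:ℝ), ∃ B' > (0:ℝ), ∀ t ≥ B', p t ≤ C * t ^ (α - 1 - ε))
    (hq_meas : Measurable q) (hq_nonneg : ∀ h, 0 ≤ q h)
    (hq_prob : ∫ h in Set.Ioi (0:ℝ), q h = 1)
    (hq_m1 : IntegrableOn (fun h => h * q h) (Set.Ioi 0))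
    (hq_m2 : IntegrableOn (fun h => h ^ 2 * q h) (Set.Ioi 0))
    (hq_m3 : IntegrableOn (fun h => h ^ 3 * q h) (Set.Ioi 0))
    {Ω : Type*} [MeasurableSpace Ω] (μ : Measure Ω) [IsProbabilityMeasure μ]
    (I : Ω → ℝ) (hI_meas : Measurable I) (hI_nonneg : ∀ ω, 0 ≤ I ω)
    (hI_laplace : ∀ s : ℝ, 0 ≤ s →
      ∫ ω, Real.exp (-(s * I ω)) ∂μ =
        Real.exp (-(lam * ∫ t in Set.Ioi (0:ℝ), ∫ h in Set.Ioi (0:ℝ),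
          (1 - Real.exp (-(s * P * h * G t))) * q h * p t)))
    (hG2_pos : 0 < ∫ t in Set.Ioi (0:ℝ), G t ^ 2 * p t) :
    ∀ x : ℝ,
      |(μ {ω | (I ω - ∫ ω', I ω' ∂μ) / Real.sqrt (variance I μ) ≤ x}).toReal -
          (∫ t in Set.Iic (x), Real.exp (-t ^ 2 / 2)) / Real.sqrt (2 * Real.pi)| ≤
        (0.4785 * ((∫ h in Set.Ioi (0:ℝ), h ^ 3 * q h) /
            (∫ h in Set.Ioi (0:ℝ), h ^ 2 * q h) ^ (3/2 : ℝ)) *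
          ((∫ t in Set.Ioi (0:ℝ), G t ^ 3 * p t) /
            (∫ t in Set.Ioi (0:ℝ), G t ^ 2 * p t) ^ (3/2 : ℝ))) / Real.sqrt lam := by
  intro x
  have hGp := integrableOn_pathLoss_mul hε hG_meas hG_nonneg hG_bdd hG_tail hp_meas hp_nonneg
    hp_loc hp_bigO
  have hGpn := integrableOn_pathLoss_pow_mul hG_meas hG_nonneg hG_bdd hp_meas hp_nonneg hGp
  have hq2_pos := integral_pow_mul_pos hq_nonneg (by simp [hq_prob]) 2 hq_m2
  let ν := (halfLineMeasure p).prod (halfLineMeasure fun h => lam * q h)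
  let X : ℝ × ℝ → ℝ := fun e => P * e.2 * G e.1
  have hlq_meas : Measurable fun h => lam * q h := hq_meas.const_mul lam
  have hlq_nonneg : ∀ h, 0 ≤ lam * q h := fun h => mul_nonneg hlam.le (hq_nonneg h)
  have hXn : ∀ n : ℕ, (fun e => X e ^ n) = fun e => G e.1 ^ n * (P ^ n * e.2 ^ n) := by
    intro n
    ext e
    simp only [X]
    ring
  have hXint : ∀ n : ℕ, IntegrableOn (fun h => h ^ (n + 1) * q h) (Set.Ioi 0) →
      Integrable (fun e => X e ^ (n + 1)) ν := by
    intro n hqn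
    rw [hXn]
    refine Integrable.mul_prod (f := fun t => G t ^ (n + 1))
      (g := fun h => P ^ (n + 1) * h ^ (n + 1))
      ((integrable_halfLineMeasure hp_meas hp_nonneg).2 (hGpn n))
      ((integrable_halfLineMeasure hlq_meas hlq_nonneg).2 ?_)
    exact (hqn.const_mul (P ^ (n + 1) * lam)).congr (ae_of_all _ fun h => by ring)
  have hXval : ∀ n : ℕ, ∫ e, X e ^ n ∂ν = lam * P ^ n * (∫ h in Set.Ioi (0:ℝ), h ^ n * q h) *
      ∫ t in Set.Ioi (0:ℝ), G t ^ n * p t := by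
    intro n
    rw [hXn, integral_prod_mul (fun t => G t ^ n) (fun h => P ^ n * h ^ n),
      integral_halfLineMeasure hp_meas hp_nonneg, integral_halfLineMeasure hlq_meas hlq_nonneg,
      mul_comm, ← integral_const_mul (lam * P ^ n)]
    congr 2
    ext h
    ring
  have h1 : Integrable X ν := by simpa using hXint 0 (by simpa using hq_m1)
  have hX0 : ∀ᵐ e ∂ν, 0 ≤ X e := by
    have hfst : ∀ᵐ e ∂ν, 0 < e.1 :=
      Measure.quasiMeasurePreserving_fst.ae (ae_halfLineMeasure_pos p)
    have hsnd : ∀ᵐ e ∂ν, 0 < e.2 :=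
      Measure.quasiMeasurePreserving_snd.ae (ae_halfLineMeasure_pos _)
    filter_upwards [hfst, hsnd] with e he1 he2
    exact mul_nonneg (mul_nonneg hP.le he2.le) (hG_nonneg _ he1.le)
  have hlap : HasPoissonLaplace I μ X ν := by
    intro s hs
    rw [hI_laplace s hs.le, integral_prod _ (integrable_one_sub_exp_neg hX0 h1 hs),
      integral_halfLineMeasure hp_meas hp_nonneg, ← integral_const_mul]
    congr 2
    refine integral_congr_ae (ae_of_all _ fun t => ?_)
    simp only [integral_halfLineMeasure hlq_meas hlq_nonneg, ← integral_const_mul,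
      ← integral_mul_const]
    refine integral_congr_ae (ae_of_all _ fun h => ?_)
    simp only [X]
    ring_nf
  have hmain := hlap.abs_measure_normalized_le_sub_le hI_nonneg hI_meas hX0 h1 (hXint 1 hq_m2)
    (hXint 2 hq_m3) (by rw [hXval]; positivity) x
  rw [hXval, hXval, lyapunov_ratio_mul hlam hP hq2_pos.le hG2_pos.le, gaussianReal_real_Iic]
    at hmain
  refine hmain.trans (le_of_eq ?_)
  ring
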